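/- arXiv:2003.05236 — 10 statements merged into one kernel-verified Lean document; each statement's English description precedes it below -/
import Mathlib

section
/- Let w be a nonnegative even integer and ε ∈ {+1,−1}. Define the linear map u_GKZ on V_w by u_GKZ(p)(X,Y) := (1/2)(p(−X−Y,X) + p(X−Y,X)). If p ∈ W_w^ε satisfies u_GKZ(p) = 0, then p = 0; i.e., u_GKZ : W_w^ε → V_w^ε is injective. -/
open MvPolynomial

/-- Substitution: `sub2 a b p` is `p(a, b)` for a bivariate polynomial `p(X,Y)`. -/
noncomputable def sub2 (a b p : MvPolynomial (Fin 2) ℚ) : MvPolynomial (Fin 2) ℚ :=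
  aeval ![a, b] p

/-- `memV w ε p` : `p ∈ V_w^ε`, i.e. `p` is homogeneous of degree `w` and
`p(-X,Y) = ε p(X,Y)`. -/
def memV (w : ℕ) (ε : ℤ) (p : MvPolynomial (Fin 2) ℚ) : Prop :=
  p.IsHomogeneous w ∧ sub2 (-X 0) (X 1) p = (ε : ℚ) • p

/-- `memW w ε p` : `p ∈ W_w^ε`, the space of period polynomials: `p ∈ V_w^ε` with
`p(X,Y) + p(-Y,X) = 0` and `p(X,Y) + p(X-Y,X) + p(-Y,X-Y) = 0`. -/
def memW (w : ℕ) (ε : ℤ) (p : MvPolynomial (Fin 2) ℚ) : Prop :=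
  memV w ε p ∧
  p + sub2 (-X 1) (X 0) p = 0 ∧
  p + sub2 (X 0 - X 1) (X 0) p + sub2 (-X 1) (X 0 - X 1) p = 0

theorem aeval_sub2 {A : Type*} [CommRing A] [Algebra ℚ A] (v : Fin 2 → A)
    (a b p : MvPolynomial (Fin 2) ℚ) :
    aeval v (sub2 a b p) = aeval ![aeval v a, aeval v b] p := by
  unfold sub2
  rw [← AlgHom.comp_apply]
  congr 1
  ext i
  fin_cases i <;> simp

theorem Polynomial.eq_zero_of_comp_X_add_C_eq_neg {f : Polynomial ℚ} (c : ℚ)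
    (hf : f.comp (Polynomial.X + Polynomial.C c) = -f) : f = 0 := by
  have hlc := congrArg Polynomial.leadingCoeff hf
  rw [Polynomial.leadingCoeff_comp (by simp), Polynomial.leadingCoeff_neg,
    Polynomial.leadingCoeff_X_add_C, one_pow, mul_one] at hlc
  exact Polynomial.leadingCoeff_eq_zero.mp (by linarith)

theorem stmt0 (w : ℕ) (hw : Even w) (ε : ℤ) (hε : ε = 1 ∨ ε = -1)
    (p : MvPolynomial (Fin 2) ℚ) (hp : memW w ε p)
    (h : (1 / 2 : ℚ) • (sub2 (-X 0 - X 1) (X 0) p + sub2 (X 0 - X 1) (X 0) p) = 0) :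
    p = 0 := by
  obtain ⟨⟨-, hδ⟩, -⟩ := hp
  refine MvPolynomial.funext fun v => ?_
  have hε' : (ε : ℚ) ≠ 0 := by rcases hε with rfl | rfl <;> norm_num
  have parity (t b : ℚ) : aeval ![-t, b] p = (ε : ℚ) * aeval ![t, b] p := by
    simpa [aeval_sub2] using congrArg (aeval ![t, b]) hδ
  have relation (b y : ℚ) : aeval ![-b - y, b] p + aeval ![b - y, b] p = 0 := by
    have key := congrArg (aeval ![b, y]) ((smul_eq_zero.mp h).resolve_left (by norm_num))
    rw [map_add, aeval_sub2, aeval_sub2] at key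
    simpa using key
  have antiperiodic (t b : ℚ) : aeval ![t + 2 * b, b] p = -aeval ![t, b] p := by
    have key := relation b (t + b)
    rw [show -b - (t + b) = -(t + 2 * b) by ring, show b - (t + b) = -t by ring,
      parity, parity, ← mul_add] at key
    exact eq_neg_of_add_eq_zero_left ((mul_eq_zero.mp key).resolve_left hε')
  let f : Polynomial ℚ := aeval ![Polynomial.X, Polynomial.C (v 1)] p
  have eval_f (t : ℚ) : f.eval t = aeval ![t, v 1] p := by
    rw [← Polynomial.coe_aeval_eq_eval, ← AlgHom.coe_toRingHom]
    change ((Polynomial.aeval t).comp (aeval ![Polynomial.X, Polynomial.C (v 1)])) p = _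
    congr 1
    ext i
    fin_cases i <;> simp
  have hf : f = 0 := by
    refine Polynomial.eq_zero_of_comp_X_add_C_eq_neg (2 * v 1) (Polynomial.funext fun t => ?_)
    simp [Polynomial.eval_comp, eval_f, antiperiodic]
  have hv := eval_f (v 0)
  rw [hf, Polynomial.eval_zero, show ![v 0, v 1] = v by ext i; fin_cases i <;> rfl] at hv
  rw [map_zero, hv]
  rfl
end

section
/- Let w be a nonnegative even integer, ε ∈ {+1,−1}, and p ∈ V_w^ε. Then p(X,Y) − p(X+Y,Y) + ε·p(X+Y,X) lies in V_w^{−ε} if and only if p ∈ W_w^ε. -/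
open MvPolynomial

theorem eval_sub2 (a b p : MvPolynomial (Fin 2) ℚ) (x y : ℚ) :
    eval ![x, y] (sub2 a b p) = eval ![eval ![x, y] a, eval ![x, y] b] p := by
  unfold sub2
  induction p using MvPolynomial.induction_on with
  | C r => simp
  | add p q hp hq => simp only [map_add, hp, hq]
  | mul_X p i hp =>
    rw [map_mul, map_mul, hp, map_mul]
    congr 1
    fin_cases i <;> simp

theorem eq_iff_eval_pair {p q : MvPolynomial (Fin 2) ℚ} :
    p = q ↔ ∀ x y : ℚ, eval ![x, y] p = eval ![x, y] q := by
  refine ⟨fun h _ _ => h ▸ rfl, fun h => MvPolynomial.funext fun v => ?_⟩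
  have hv : v = ![v 0, v 1] := by ext i; fin_cases i <;> rfl
  rw [hv]
  exact h _ _

theorem isHomogeneous_sub2 {a b p : MvPolynomial (Fin 2) ℚ} {w : ℕ} (hp : p.IsHomogeneous w)
    (ha : a.IsHomogeneous 1) (hb : b.IsHomogeneous 1) : (sub2 a b p).IsHomogeneous w := by
  have h := hp.aeval ![a, b] (n := 1) fun i => by fin_cases i <;> simpa
  simpa [sub2] using h

theorem eval_mul_pair {p : MvPolynomial (Fin 2) ℚ} {w : ℕ} (hp : p.IsHomogeneous w)
    (t x y : ℚ) : eval ![t * x, t * y] p = t ^ w * eval ![x, y] p := by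
  have ht : ![t * x, t * y] = fun i => t * ![x, y] i := by ext i; fin_cases i <;> simp
  rw [ht, eval_eq, eval_eq, Finset.mul_sum]
  refine Finset.sum_congr rfl fun d hd => ?_
  have hd' : ∑ i ∈ d.support, d i = w := by
    rw [← hp (mem_support_iff.mp hd), Finsupp.weight_apply]
    simp [Finsupp.sum]
  simp only [mul_pow, Finset.prod_mul_distrib, Finset.prod_pow_eq_pow_sum, hd']
  ring

/-- A polynomial invariant under `(x, y) ↦ (x + y, y)` depends only on `y`. -/
theorem eval_eq_of_translation_invariant {u : MvPolynomial (Fin 2) ℚ}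
    (hT : ∀ x y : ℚ, eval ![x + y, y] u = eval ![x, y] u) (x : ℚ) {y : ℚ} (hy : y ≠ 0) :
    eval ![x, y] u = eval ![0, y] u := by
  set q : Polynomial ℚ :=
    aeval ![Polynomial.X * Polynomial.C y, Polynomial.C y] u with hq
  have key (t : ℚ) : q.eval t = eval ![t * y, y] u := by
    rw [hq]
    clear hT hq q
    induction u using MvPolynomial.induction_on with
    | C r => simp
    | add p q hp hq => simp only [map_add, Polynomial.eval_add, hp, hq]
    | mul_X p i hp =>
      rw [map_mul, Polynomial.eval_mul, hp, map_mul]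
      congr 1
      fin_cases i <;> simp [mul_comm t y]
  have hn (n : ℕ) : q.eval (n : ℚ) = eval ![0, y] u := by
    rw [key]
    induction n with
    | zero => simp
    | succ n ih => rw [← ih, Nat.cast_succ, add_one_mul, hT]
  have hc : q = Polynomial.C (eval ![0, y] u) := by
    refine Polynomial.eq_of_infinite_eval_eq _ _
      ((Set.infinite_range_of_injective (Nat.cast_injective (R := ℚ))).mono ?_)
    rintro _ ⟨n, rfl⟩
    simpa using hn n
  have h := key (x / y)
  rwa [hc, Polynomial.eval_C, div_mul_cancel₀ _ hy, eq_comm] at h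

theorem stmt1 (w : ℕ) (hw : Even w) (ε : ℤ) (hε : ε = 1 ∨ ε = -1)
    (p : MvPolynomial (Fin 2) ℚ) (hp : memV w ε p) :
    memV w (-ε) (p - sub2 (X 0 + X 1) (X 1) p + (ε : ℚ) • sub2 (X 0 + X 1) (X 0) p)
      ↔ memW w ε p := by
  have hX : (X 0 : MvPolynomial (Fin 2) ℚ).IsHomogeneous 1 := isHomogeneous_X _ _
  have hY : (X 1 : MvPolynomial (Fin 2) ℚ).IsHomogeneous 1 := isHomogeneous_X _ _
  have hom : (p - sub2 (X 0 + X 1) (X 1) p +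
      (ε : ℚ) • sub2 (X 0 + X 1) (X 0) p).IsHomogeneous w := by
    refine (hp.1.sub (isHomogeneous_sub2 hp.1 (hX.add hY) hY)).add ?_
    rw [MvPolynomial.smul_eq_C_mul]
    exact (isHomogeneous_sub2 hp.1 (hX.add hY) hX).C_mul _
  have hhom := eval_mul_pair hp.1
  have hpar := hp.2
  have hneg (x y : ℚ) : eval ![-x, -y] p = eval ![x, y] p := by
    simpa [hw.neg_pow] using hhom (-1) x y
  simp only [memV, memW, hp.1, hp.2, hom, true_and]
  have hε2 : (ε : ℚ) * ε = 1 := by rcases hε with rfl | rfl <;> norm_num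
  set e : ℚ := (ε : ℚ) with he
  push_cast
  rw [← he]
  simp only [eq_iff_eval_pair, map_add, map_sub, eval_sub2, map_neg, eval_X, smul_eval,
    Matrix.cons_val_zero, Matrix.cons_val_one, map_zero] at hpar ⊢
  have hpar' (x y : ℚ) : eval ![x, -y] p = e * eval ![x, y] p := by
    rw [← hpar, ← hneg]; simp
  have hsub (a b c : ℚ) : eval ![b - a, c] p = e * eval ![a - b, c] p := by
    rw [← hpar, neg_sub]
  constructor
  · intro h
    have hA (x y : ℚ) : 2 * eval ![x, y] p = eval ![x - y, y] p + eval ![x + y, y] p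
        - eval ![x - y, x] p - e * eval ![x + y, x] p := by
      have h1 := h x y
      rw [neg_add_eq_sub, hpar, hpar', hsub, hsub x y x] at h1
      linear_combination e * h1 + (-2 * eval ![x, y] p + eval ![x - y, y] p
        + eval ![x + y, y] p - eval ![x - y, x] p * (1 + e * e)
        - e * eval ![x + y, x] p) * hε2
    have hsw (x y : ℚ) : eval ![y, x] p = -e * eval ![x, y] p := by
      have h1 := hA y x
      rw [hsub x y x, hsub x y y, add_comm y x] at h1
      linear_combination h1 / 2 + e * hA x y / 2 - eval ![x + y, x] p / 2 * hε2
    obtain ⟨u, hu⟩ : ∃ u, u = p + sub2 (X 0 - X 1) (X 0) p + sub2 (-X 1) (X 0 - X 1) p :=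
      ⟨_, rfl⟩
    have hue (x y : ℚ) : eval ![x, y] u
        = eval ![x, y] p + eval ![x - y, x] p + eval ![-y, x - y] p := by
      rw [hu]
      simp [eval_sub2]
    have hue' (x y : ℚ) : eval ![x, y] u
        = eval ![x, y] p + eval ![x - y, x] p - eval ![x - y, y] p := by
      rw [hue, hpar, hsw (x - y) y]
      linear_combination -eval ![x - y, y] p * hε2
    have hur (x y : ℚ) : eval ![x, -y] u = -e * eval ![x, y] u := by
      rw [hue', hue', sub_neg_eq_add, hpar', hpar']
      linear_combination e * hA x y - eval ![x + y, x] p * hε2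
    have huneg (x y : ℚ) : eval ![-x, -y] u = eval ![x, y] u := by
      rw [hue', hue', hneg, ← hneg (-x - -y), ← hneg (-x - -y)]
      ring_nf
    have husw (x y : ℚ) : eval ![y, x] u = -e * eval ![x, y] u := by
      rw [hue', hue', hsub x y y, hsub x y x, hsw x y]
      ring
    have huU (x y : ℚ) : eval ![x - y, x] u = eval ![x, y] u := by
      rw [hue, hue, ← hneg x y]
      ring_nf
    have huT (x y : ℚ) : eval ![x + y, y] u = eval ![x, y] u := by
      have h1 := huU (x + y) x
      have h2 := huU x (-y)
      rw [add_sub_cancel_left, husw (x + y) y] at h1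
      rw [sub_neg_eq_add, hur] at h2
      linear_combination -e * (h1 + h2) + (eval ![x, y] u - eval ![x + y, y] u) * hε2
    have hu0 (x y : ℚ) (hy : y ≠ 0) : eval ![x, y] u = 0 := by
      have hc := eval_eq_of_translation_invariant huT
      rw [hc x hy]
      rcases hε with rfl | rfl
      · have h1 := huneg 0 y
        rw [neg_zero, hur, he] at h1
        push_cast at h1
        linarith
      · have he' : e = -1 := by rw [he]; norm_num
        have hc1 (z : ℚ) (hz : z ≠ 0) : eval ![0, z] u = eval ![0, 1] u := by
          rw [← hc 1 hz, husw z 1, he', neg_neg, one_mul, hc z one_ne_zero]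
        rw [hc1 y hy]
        rcases eq_or_ne w 0 with rfl | hw0
        · have hP0 (a b : ℚ) : eval ![a, b] p = 0 := by
            have h1 := hhom 0 a b
            have h2 := hpar 0 0
            simp only [zero_mul, pow_zero, one_mul, neg_zero, he'] at h1 h2
            linarith
          simp [hue', hP0]
        · have h2 : eval ![0, 2] u = 2 ^ w * eval ![0, 1] u := by
            have h3 := hhom 2 0 1
            have h4 := hhom 2 (0 - 1) 0
            have h5 := hhom 2 (0 - 1) 1
            norm_num at h3 h4 h5
            norm_num [hue', h3, h4, h5]
            ring
          have h3 : (1 : ℚ) < 2 ^ w := one_lt_pow₀ one_lt_two hw0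
          rw [hc1 2 two_ne_zero] at h2
          have h4 : ((2 : ℚ) ^ w - 1) * eval ![0, 1] u = 0 := by linear_combination -h2
          exact (mul_eq_zero.mp h4).resolve_left (by linarith)
    have hu00 : u = 0 := by
      have : X 1 * u = 0 := by
        rw [eq_iff_eval_pair]
        intro x y
        by_cases hy : y = 0
        · simp [hy]
        · simp [hu0 x y hy]
      exact (mul_eq_zero.mp this).resolve_left (X_ne_zero 1)
    refine ⟨fun x y => ?_, fun x y => ?_⟩
    · rw [hpar, hsw x y]
      linear_combination -eval ![x, y] p * hε2
    · rw [← hue, hu00, map_zero]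
  · rintro ⟨hS, hU⟩ x y
    have hsw (x y : ℚ) : eval ![y, x] p = -e * eval ![x, y] p := by
      have h1 := hS x y
      rw [hpar] at h1
      linear_combination e * h1 - eval ![y, x] p * hε2
    have hB (x y : ℚ) : eval ![x, y] p = eval ![x - y, y] p - eval ![x - y, x] p := by
      have h1 := hU x y
      rw [hpar, hsw (x - y) y] at h1
      linear_combination h1 + eval ![x - y, y] p * hε2
    have hB' := hB x (-y)
    rw [sub_neg_eq_add, hpar', hpar'] at hB'
    rw [neg_add_eq_sub, hpar, hpar', hsub, hsub x y x]
    linear_combination e * hB x y + hB' + (eval ![x - y, x] p * e + eval ![x + y, x] p) * hε2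
end

section
/- Let w be an odd positive integer and ε ∈ {+1,−1}. Let p ∈ W_{w−1}^{−ε} and q ∈ W_{w+1}^{ε}. If Y·p(X,Y) + (∂q/∂X)(X,Y) = 0, then p = 0 and q = 0. -/
open MvPolynomial

/-- The chain rule for the rotation `(X, Y) ↦ (-Y, X)`. -/
theorem pderiv_one_sub2_rotation (q : MvPolynomial (Fin 2) ℚ) :
    pderiv 1 (sub2 (-X 1) (X 0) q) = -sub2 (-X 1) (X 0) (pderiv 0 q) := by
  unfold sub2
  induction q using MvPolynomial.induction_on with
  | C a => simp
  | add f g hf hg =>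
    simp only [map_add, hf, hg]
    ring
  | mul_X f i hf =>
    simp only [map_mul, Derivation.leibniz, smul_eq_mul, map_add, hf, aeval_X]
    fin_cases i <;> simp
    ring

theorem stmt2 (w : ℕ) (hw : Odd w) (hpos : 0 < w) (ε : ℤ) (hε : ε = 1 ∨ ε = -1)
    (p q : MvPolynomial (Fin 2) ℚ) (hp : memW (w - 1) (-ε) p) (hq : memW (w + 1) ε q)
    (h : X 1 * p + pderiv 0 q = 0) :
    p = 0 ∧ q = 0 := by
  obtain ⟨-, hpS, -⟩ := hp
  obtain ⟨⟨hq_hom, -⟩, hqS, -⟩ := hq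
  have h_rot : X 0 * sub2 (-X 1) (X 0) p + sub2 (-X 1) (X 0) (pderiv 0 q) = 0 := by
    simpa [sub2] using congrArg (sub2 (-X 1) (X 0)) h
  have h_deriv : pderiv 1 q - sub2 (-X 1) (X 0) (pderiv 0 q) = 0 := by
    simpa [pderiv_one_sub2_rotation, sub_eq_add_neg] using congrArg (pderiv 1) hqS
  have euler := hq_hom.sum_X_mul_pderiv
  rw [Fin.sum_univ_two] at euler
  have hq0 : q = 0 := by
    have : (w + 1) • q = 0 := by
      rw [← euler]
      linear_combination X 0 * h + X 1 * h_deriv + X 1 * h_rot - X 0 * X 1 * hpS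
    exact (smul_eq_zero.mp this).resolve_left w.succ_ne_zero
  subst hq0
  exact ⟨by simpa using h, rfl⟩
end

section
/- Let w be an odd positive integer, ε ∈ {+1,−1}, and C ∈ V_w^ε. Define D(X,Y) := (∂C/∂X)(X,Y) + ε·(∂/∂Y)[C(Y,X)] (the second term being the partial derivative with respect to Y of the polynomial obtained by substituting (Y,X) into C), L(X,Y) := ε·C(X+Y,X) + C(X+Y,Y) − C(X,Y), S(X,Y) := (1/2)(L(X,Y) + ε·L(−X,Y)), S₁(X,Y) := (∂/∂X)[S(X,Y) + ε·S(Y,X)], and S₂(X,Y) := (∂/∂X)[S(X,Y) − ε·S(Y,X)]. Then ε·D(X+Y,X) + D(X+Y,Y) − D(X,Y) = S₁(X,Y) − S₂(X,X+Y). -/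
open MvPolynomial

section Substitution

variable (a b c d p q : MvPolynomial (Fin 2) ℚ)

theorem sub2_X_zero : sub2 a b (X 0) = a := by simp [sub2]

theorem sub2_X_one : sub2 a b (X 1) = b := by simp [sub2]

theorem sub2_X_zero_X_one : sub2 (X 0) (X 1) p = p := by
  have h : ![X 0, X 1] = (X : Fin 2 → MvPolynomial (Fin 2) ℚ) := by
    funext i
    fin_cases i <;> rfl
  rw [sub2, h, aeval_X_left_apply]

theorem sub2_add : sub2 a b (p + q) = sub2 a b p + sub2 a b q := map_add _ _ _

theorem sub2_sub : sub2 a b (p - q) = sub2 a b p - sub2 a b q := map_sub _ _ _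

theorem sub2_neg : sub2 a b (-p) = -sub2 a b p := map_neg _ _

theorem sub2_smul (r : ℚ) : sub2 a b (r • p) = r • sub2 a b p := map_smul _ _ _

theorem sub2_sub2 : sub2 a b (sub2 c d p) = sub2 (sub2 a b c) (sub2 a b d) p := by
  induction p using MvPolynomial.induction_on with
  | C r => simp [sub2]
  | add p q hp hq => simp only [sub2_add, hp, hq]
  | mul_X p i hp =>
    simp only [sub2, map_mul, aeval_X] at hp ⊢
    rw [hp]
    fin_cases i <;> simp

/-- The chain rule for bivariate substitutions. -/
theorem pderiv_sub2 (i : Fin 2) :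
    pderiv i (sub2 a b p) =
      pderiv i a * sub2 a b (pderiv 0 p) + pderiv i b * sub2 a b (pderiv 1 p) := by
  induction p using MvPolynomial.induction_on with
  | C r => simp [sub2, algebraMap_eq]
  | add p q hp hq => simp only [sub2_add, map_add, hp, hq]; ring
  | mul_X p j hp =>
    simp only [sub2, map_mul, map_add, aeval_X, Derivation.leibniz, smul_eq_mul] at hp ⊢
    rw [hp]
    fin_cases j <;> simp [pderiv_X] <;> ring

theorem sub2_neg_neg {w : ℕ} (hw : Odd w) (hp : p.IsHomogeneous w) :
    sub2 (-a) (-b) p = -sub2 a b p := by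
  simp only [sub2, aeval_def, eval₂_eq', ← Finset.sum_neg_distrib]
  refine Finset.sum_congr rfl fun d hd => ?_
  have hdeg : d 0 + d 1 = w := by
    have h := hp (mem_support_iff.mp hd)
    rwa [Pi.one_def, ← Finsupp.degree_eq_weight_one, Finsupp.degree_eq_sum,
      Fin.sum_univ_two] at h
  simp only [Fin.prod_univ_two, Matrix.cons_val_zero, Matrix.cons_val_one, neg_pow a, neg_pow b]
  have hsign : (-1 : MvPolynomial (Fin 2) ℚ) ^ d 0 * (-1) ^ d 1 = -1 := by
    rw [← pow_add, hdeg, hw.neg_one_pow]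
  linear_combination (algebraMap ℚ _ (coeff d p) * a ^ d 0 * b ^ d 1) * hsign

theorem sub2_neg_left {w : ℕ} {ε : ℤ} (hp : memV w ε p) :
    sub2 (-a) b p = (ε : ℚ) • sub2 a b p := by
  have h := congrArg (sub2 a b) hp.2
  rwa [sub2_sub2, sub2_smul, sub2_neg, sub2_X_zero, sub2_X_one] at h

theorem sub2_neg_left_pderiv_zero {w : ℕ} {ε : ℤ} (hp : memV w ε p) :
    sub2 (-a) b (pderiv 0 p) = -((ε : ℚ) • sub2 a b (pderiv 0 p)) := by
  have h := congrArg (fun q => sub2 a b (pderiv 0 q)) hp.2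
  simp only [pderiv_sub2, map_neg, Derivation.map_smul, pderiv_X_self, neg_mul, one_mul,
    pderiv_X_of_ne (show (1 : Fin 2) ≠ 0 by decide), zero_mul, add_zero,
    sub2_neg, sub2_smul, sub2_sub2, sub2_X_zero, sub2_X_one] at h
  rw [← h, neg_neg]

theorem sub2_neg_left_pderiv_one {w : ℕ} {ε : ℤ} (hp : memV w ε p) :
    sub2 (-a) b (pderiv 1 p) = (ε : ℚ) • sub2 a b (pderiv 1 p) := by
  have h := congrArg (fun q => sub2 a b (pderiv 1 q)) hp.2
  simpa only [pderiv_sub2, map_neg, Derivation.map_smul, pderiv_X_self, neg_zero, one_mul,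
    pderiv_X_of_ne (show (0 : Fin 2) ≠ 1 by decide), zero_mul, zero_add,
    sub2_neg, sub2_smul, sub2_sub2, sub2_X_zero, sub2_X_one] using h

end Substitution

theorem stmt5 (w : ℕ) (hw : Odd w) (hpos : 0 < w) (ε : ℤ) (hε : ε = 1 ∨ ε = -1)
    (Cp : MvPolynomial (Fin 2) ℚ) (hC : memV w ε Cp)
    (D L S S1 S2 : MvPolynomial (Fin 2) ℚ)
    (hD : D = pderiv 0 Cp + (ε : ℚ) • pderiv 1 (sub2 (X 1) (X 0) Cp))
    (hL : L = (ε : ℚ) • sub2 (X 0 + X 1) (X 0) Cp + sub2 (X 0 + X 1) (X 1) Cp - Cp)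
    (hS : S = (1 / 2 : ℚ) • (L + (ε : ℚ) • sub2 (-X 0) (X 1) L))
    (hS1 : S1 = pderiv 0 (S + (ε : ℚ) • sub2 (X 1) (X 0) S))
    (hS2 : S2 = pderiv 0 (S - (ε : ℚ) • sub2 (X 1) (X 0) S)) :
    (ε : ℚ) • sub2 (X 0 + X 1) (X 0) D + sub2 (X 0 + X 1) (X 1) D - D
      = S1 - sub2 (X 0) (X 0 + X 1) S2 := by
  have hε2 : (ε : ℚ) * ε = 1 := by rcases hε with rfl | rfl <;> norm_num
  have hodd (a b) : sub2 (-a) (-b) Cp = -sub2 a b Cp := sub2_neg_neg a b Cp hw hC.1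
  have hleft (a b) : sub2 (-a) b Cp = (ε : ℚ) • sub2 a b Cp := sub2_neg_left a b Cp hC
  have hLneg : sub2 (-X 0) (X 1) L =
      -((ε : ℚ) • sub2 (X 0 - X 1) (X 0) Cp) + (ε : ℚ) • sub2 (X 0 - X 1) (X 1) Cp
        - (ε : ℚ) • Cp := by
    have e : -X 0 + X 1 = -(X 0 - X 1 : MvPolynomial (Fin 2) ℚ) := by ring
    simp only [hL, sub2_add, sub2_sub, sub2_smul, sub2_sub2, sub2_X_zero, sub2_X_one, e, hodd,
      hleft, smul_neg, sub2_X_zero_X_one]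
  have hS' : S = (1 / 2 : ℚ) • ((ε : ℚ) • sub2 (X 0 + X 1) (X 0) Cp + sub2 (X 0 + X 1) (X 1) Cp
      - sub2 (X 0 - X 1) (X 0) Cp + sub2 (X 0 - X 1) (X 1) Cp) - Cp := by
    rw [hS, hLneg, hL]
    simp only [smul_add, smul_sub, smul_neg, smul_smul, hε2, one_smul]
    module
  have hST : (ε : ℚ) • sub2 (X 1) (X 0) S =
      (1 / 2 : ℚ) • ((ε : ℚ) • sub2 (X 0 + X 1) (X 0) Cp + sub2 (X 0 + X 1) (X 1) Cp
        + sub2 (X 0 - X 1) (X 0) Cp - sub2 (X 0 - X 1) (X 1) Cp)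
        - (ε : ℚ) • sub2 (X 1) (X 0) Cp := by
    have e : X 1 - X 0 = -(X 0 - X 1 : MvPolynomial (Fin 2) ℚ) := by ring
    simp only [hS', sub2_add, sub2_sub, sub2_smul, sub2_sub2, sub2_X_zero, sub2_X_one, e,
      hleft, add_comm (X 1 : MvPolynomial (Fin 2) ℚ) (X 0)]
    rcases hε with rfl | rfl <;> push_cast <;> module
  have hsum : S + (ε : ℚ) • sub2 (X 1) (X 0) S =
      (ε : ℚ) • sub2 (X 0 + X 1) (X 0) Cp + sub2 (X 0 + X 1) (X 1) Cp
        - Cp - (ε : ℚ) • sub2 (X 1) (X 0) Cp := by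
    rw [hST, hS']
    module
  have hdiff : S - (ε : ℚ) • sub2 (X 1) (X 0) S =
      sub2 (X 0 - X 1) (X 1) Cp - sub2 (X 0 - X 1) (X 0) Cp
        - Cp + (ε : ℚ) • sub2 (X 1) (X 0) Cp := by
    rw [hST, hS']
    module
  have e : X 0 - (X 0 + X 1) = -(X 1 : MvPolynomial (Fin 2) ℚ) := by ring
  rw [hS1, hS2, hsum, hdiff, hD]
  simp only [pderiv_sub2, map_add, map_sub, Derivation.map_smul, pderiv_X_self,
    pderiv_X_of_ne (show (1 : Fin 2) ≠ 0 by decide),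
    pderiv_X_of_ne (show (0 : Fin 2) ≠ 1 by decide), zero_mul, one_mul, add_zero, zero_add,
    sub_zero, sub2_add, sub2_sub, sub2_smul, sub2_sub2, sub2_X_zero, sub2_X_one, e,
    sub2_neg_left_pderiv_zero _ _ _ hC, sub2_neg_left_pderiv_one _ _ _ hC]
  rcases hε with rfl | rfl <;> push_cast <;> module
end

section
/- Let w be a nonnegative even integer and let V_w^{−,sym} be the space of p ∈ V_w with p(−X,Y) = −p(X,Y) and p(X,Y) = p(Y,X). Define α(p)(X,Y) := p(−X−Y,−Y) + p(−X,−X−Y) − p(X−Y,X) − p(−Y,X−Y). Then α maps V_w^{−,sym} into itself, for every p ∈ V_w^{−,sym} with integer coefficients one has α(α(p)) ≡ p modulo 3 (coefficientwise), and consequently α : V_w^{−,sym} → V_w^{−,sym} is a linear bijection. -/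
open MvPolynomial

/-- The space of symmetric odd homogeneous polynomials of degree `w`. -/
def memVsym (w : ℕ) (p : MvPolynomial (Fin 2) ℚ) : Prop :=
  p.IsHomogeneous w ∧ sub2 (-X 0) (X 1) p = -p ∧ sub2 (X 1) (X 0) p = p

/-- `α(p)(X,Y) = p(-X-Y,-Y) + p(-X,-X-Y) - p(X-Y,X) - p(-Y,X-Y)`. -/
noncomputable def alphaMap (p : MvPolynomial (Fin 2) ℚ) : MvPolynomial (Fin 2) ℚ :=
  sub2 (-X 0 - X 1) (-X 1) p + sub2 (-X 0) (-X 0 - X 1) p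
    - sub2 (X 0 - X 1) (X 0) p - sub2 (-X 1) (X 0 - X 1) p

/-- A function of two variables that is symmetric and odd in its first variable. -/
structure IsOddSymm {S T : Type*} [Neg S] [Neg T] (f : S → S → T) : Prop where
  neg_left : ∀ a b, f (-a) b = -f a b
  symm : ∀ a b, f a b = f b a

/-- The operator `α` on functions of two variables. -/
def alphaFun {S T : Type*} [Ring S] [Ring T] (f : S → S → T) (a b : S) : T :=
  f (-a - b) (-b) + f (-a) (-a - b) - f (a - b) a - f (-b) (a - b)

namespace IsOddSymm

variable {S T : Type*} [Ring S] [Ring T] {f : S → S → T}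

theorem neg_right (hf : IsOddSymm f) (a b : S) : f a (-b) = -f a b := by
  rw [hf.symm, hf.neg_left, hf.symm]

theorem alphaFun_apply (hf : IsOddSymm f) (a b : S) :
    alphaFun f a b = f (a + b) b + f (a + b) a - f (a - b) a + f (a - b) b := by
  have h : -a - b = -(a + b) := by abel
  rw [alphaFun, h, hf.neg_left, hf.neg_right, hf.neg_left, hf.neg_right, hf.neg_left,
    hf.symm a, hf.symm b]
  abel

theorem alphaFun_isOddSymm (hf : IsOddSymm f) : IsOddSymm (alphaFun f) where
  neg_left a b := by
    have h₁ : -a + b = -(a - b) := by abel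
    have h₂ : -a - b = -(a + b) := by abel
    rw [hf.alphaFun_apply, hf.alphaFun_apply, h₁, h₂]
    simp only [hf.neg_left, hf.neg_right]
    abel
  symm a b := by
    have h : b - a = -(a - b) := by abel
    rw [hf.alphaFun_apply, hf.alphaFun_apply, h, add_comm b a]
    simp only [hf.neg_left]
    abel

/-- In characteristic three, `α` is an involution on odd symmetric functions. -/
theorem alphaFun_involutive (hf : IsOddSymm f) (hS : ∀ x : S, x + x + x = 0)
    (hT : ∀ x : T, x + x + x = 0) (a b : S) :
    alphaFun (alphaFun f) a b = f a b := by
  have two (x : S) : x + x = -x := eq_neg_of_add_eq_zero_left (hS x)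
  have h₁ : a + b + b = a - b := by rw [add_assoc, two, sub_eq_add_neg]
  have h₂ : a + b - b = a := by abel
  have h₃ : a + b + a = -(a - b) := by rw [add_right_comm, two]; abel
  have h₄ : a + b - a = b := by abel
  have h₅ : a - b + a = -(a + b) := by rw [sub_add_eq_add_sub, two]; abel
  have h₆ : a - b - a = -b := by abel
  have h₇ : a - b + b = a := by abel
  have h₈ : a - b - b = a + b := by rw [sub_sub, two, sub_neg_eq_add]
  rw [hf.alphaFun_isOddSymm.alphaFun_apply]
  simp only [hf.alphaFun_apply, h₁, h₂, h₃, h₄, h₅, h₆, h₇, h₈, hf.neg_left]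
  rw [hf.symm b a, hf.symm a (a + b), hf.symm b (a + b), hf.symm b (a - b), hf.symm a (a - b),
    hf.symm (a - b) (a + b)]
  rw [← sub_eq_zero, ← hT (f a b)]
  abel

end IsOddSymm

section Polynomials

variable {R : Type*} [CommRing R]

/-- The operator `α` on bivariate polynomials over an arbitrary commutative ring. -/
noncomputable def alphaPoly (p : MvPolynomial (Fin 2) R) : MvPolynomial (Fin 2) R :=
  alphaFun (fun a b => aeval ![a, b] p) (X 0) (X 1)

/-- Symmetric polynomials that are odd in the first variable. -/
def IsOddSymmPoly (p : MvPolynomial (Fin 2) R) : Prop :=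
  aeval ![-X 0, X 1] p = -p ∧ aeval ![X 1, X 0] p = p

theorem aeval_aeval_pair {S : Type*} [CommRing S] [Algebra R S] (x y : S)
    (a b p : MvPolynomial (Fin 2) R) :
    aeval ![x, y] (aeval ![a, b] p) = aeval ![aeval ![x, y] a, aeval ![x, y] b] p := by
  rw [← AlgHom.comp_apply, comp_aeval]
  congr 2
  ext i
  fin_cases i <;> rfl

theorem aeval_pair_X (p : MvPolynomial (Fin 2) R) : aeval ![X 0, X 1] p = p := by
  convert aeval_X_left_apply p
  ext i
  fin_cases i <;> rfl

theorem IsOddSymmPoly.isOddSymm {p : MvPolynomial (Fin 2) R} (hp : IsOddSymmPoly p)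
    (S : Type*) [CommRing S] [Algebra R S] :
    IsOddSymm (fun a b : S => aeval ![a, b] p) where
  neg_left a b := by
    have h := congrArg (aeval ![a, b]) hp.1
    simpa [aeval_aeval_pair, -aeval_eq_bind₁] using h
  symm a b := by
    have h := congrArg (aeval ![a, b]) hp.2
    simpa [aeval_aeval_pair, -aeval_eq_bind₁] using h.symm

theorem aeval_alphaPoly {S : Type*} [CommRing S] [Algebra R S] (x y : S)
    (p : MvPolynomial (Fin 2) R) :
    aeval ![x, y] (alphaPoly p) = alphaFun (fun a b => aeval ![a, b] p) x y := by
  simp [alphaPoly, alphaFun, aeval_aeval_pair, -aeval_eq_bind₁]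

theorem IsOddSymmPoly.alphaPoly_isOddSymmPoly {p : MvPolynomial (Fin 2) R} (hp : IsOddSymmPoly p) :
    IsOddSymmPoly (alphaPoly p) := by
  have h := (hp.isOddSymm (MvPolynomial (Fin 2) R)).alphaFun_isOddSymm
  constructor
  · rw [aeval_alphaPoly]
    exact h.neg_left _ _
  · rw [aeval_alphaPoly]
    exact h.symm _ _

theorem IsOddSymmPoly.alphaPoly_involutive {p : MvPolynomial (Fin 2) R}
    (hp : IsOddSymmPoly p) (hR : (3 : R) = 0) :
    alphaPoly (alphaPoly p) = p := by
  have h3 (x : MvPolynomial (Fin 2) R) : x + x + x = 0 := by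
    have : (3 : MvPolynomial (Fin 2) R) = 0 := by
      rw [← map_ofNat (C : R →+* MvPolynomial (Fin 2) R) 3, hR, map_zero]
    linear_combination x * this
  rw [alphaPoly]
  simp only [aeval_alphaPoly]
  rw [(hp.isOddSymm _).alphaFun_involutive h3 h3, aeval_pair_X]

theorem map_aeval_pair {S : Type*} [CommRing S] (φ : R →+* S) (a b p : MvPolynomial (Fin 2) R) :
    map φ (aeval ![a, b] p) = aeval ![map φ a, map φ b] (map φ p) := by
  induction p using MvPolynomial.induction_on with
  | C r => simp [algebraMap_eq]
  | add p q hp hq => rw [map_add, map_add, hp, hq, map_add, map_add]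
  | mul_X p i hp =>
    simp only [map_mul, hp, aeval_X, map_X]
    fin_cases i <;> rfl

theorem map_alphaPoly {S : Type*} [CommRing S] (φ : R →+* S) (p : MvPolynomial (Fin 2) R) :
    map φ (alphaPoly p) = alphaPoly (map φ p) := by
  simp [alphaPoly, alphaFun, map_aeval_pair, -aeval_eq_bind₁, -map_aeval]

theorem IsOddSymmPoly.map {S : Type*} [CommRing S] (φ : R →+* S)
    {p : MvPolynomial (Fin 2) R} (hp : IsOddSymmPoly p) :
    IsOddSymmPoly (MvPolynomial.map φ p) := by
  constructor
  · simpa [map_aeval_pair, -aeval_eq_bind₁, -map_aeval] using congrArg (MvPolynomial.map φ) hp.1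
  · simpa [map_aeval_pair, -aeval_eq_bind₁, -map_aeval] using congrArg (MvPolynomial.map φ) hp.2

theorem IsOddSymmPoly.of_map {S : Type*} [CommRing S] {φ : R →+* S}
    (hφ : Function.Injective φ) {p : MvPolynomial (Fin 2) R}
    (hp : IsOddSymmPoly (MvPolynomial.map φ p)) : IsOddSymmPoly p := by
  constructor <;> apply map_injective φ hφ
  · simpa [map_aeval_pair, -aeval_eq_bind₁, -map_aeval] using hp.1
  · simpa [map_aeval_pair, -aeval_eq_bind₁, -map_aeval] using hp.2

theorem alphaPoly_add (p q : MvPolynomial (Fin 2) R) :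
    alphaPoly (p + q) = alphaPoly p + alphaPoly q := by
  simp only [alphaPoly, alphaFun, map_add]
  ring

theorem alphaPoly_smul (c : R) (p : MvPolynomial (Fin 2) R) :
    alphaPoly (c • p) = c • alphaPoly p := by
  simp only [alphaPoly, alphaFun, map_smul, smul_add, smul_sub]

theorem IsHomogeneous.alphaPoly {p : MvPolynomial (Fin 2) R} {n : ℕ} (hp : p.IsHomogeneous n) :
    (alphaPoly p).IsHomogeneous n := by
  have h (a b : MvPolynomial (Fin 2) R) (ha : a.IsHomogeneous 1) (hb : b.IsHomogeneous 1) :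
      (aeval ![a, b] p).IsHomogeneous n := by
    rw [← one_mul n]
    refine hp.aeval _ fun i => ?_
    fin_cases i
    · exact ha
    · exact hb
  have h₀ := isHomogeneous_X R (0 : Fin 2)
  have h₁ := isHomogeneous_X R (1 : Fin 2)
  exact (((h _ _ (h₀.neg.sub h₁) h₁.neg).add (h _ _ h₀.neg (h₀.neg.sub h₁))).sub
    (h _ _ (h₀.sub h₁) h₀)).sub (h _ _ h₁.neg (h₀.sub h₁))

end Polynomials

theorem IsOddSymmPoly.three_dvd {p : MvPolynomial (Fin 2) ℤ} (hp : IsOddSymmPoly p) :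
    C 3 ∣ alphaPoly (alphaPoly p) - p := by
  rw [C_dvd_iff_map_hom_eq_zero (Int.castRingHom (ZMod 3)) 3
    fun r => by simpa using ZMod.intCast_zmod_eq_zero_iff_dvd r 3]
  rw [map_sub, map_alphaPoly, map_alphaPoly,
    (hp.map (Int.castRingHom (ZMod 3))).alphaPoly_involutive (by decide), sub_self]

theorem IsOddSymmPoly.eq_zero_of_image_eq_zero_int {p : MvPolynomial (Fin 2) ℤ}
    (hp : IsOddSymmPoly p) (h : alphaPoly p = 0) : p = 0 := by
  have hpow (n : ℕ) : ∃ q, p = (3 : ℤ) ^ n • q := by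
    induction n with
    | zero => exact ⟨p, by simp⟩
    | succ n ih =>
      obtain ⟨q, rfl⟩ := ih
      have h3 : (3 : ℤ) ^ n ≠ 0 := by positivity
      have hα : alphaPoly q = 0 := by
        rw [alphaPoly_smul] at h
        exact (smul_eq_zero.mp h).resolve_left h3
      have hq : IsOddSymmPoly q := by
        constructor <;> apply smul_right_injective _ h3
        · simpa only [map_smul, smul_neg] using hp.1
        · simpa only [map_smul] using hp.2
      obtain ⟨r, hr⟩ := hq.three_dvd
      have h0 : alphaPoly (0 : MvPolynomial (Fin 2) ℤ) = 0 := by simp [alphaPoly, alphaFun]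
      rw [hα, h0, zero_sub, C_mul'] at hr
      refine ⟨-r, ?_⟩
      rw [← neg_neg q, hr, pow_succ, mul_smul]
      simp only [smul_neg]
  ext m
  rw [coeff_zero]
  by_contra hm
  have hfin : FiniteMultiplicity (3 : ℤ) (coeff m p) :=
    Int.finiteMultiplicity_iff.mpr ⟨by decide, hm⟩
  obtain ⟨n, hn⟩ := hfin
  obtain ⟨q, hq⟩ := hpow (n + 1)
  exact hn ⟨coeff m q, by rw [hq, coeff_smul, smul_eq_mul]⟩

theorem exists_map_intCast_eq {p : MvPolynomial (Fin 2) ℚ}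
    (hp : ∀ m, ∃ k : ℤ, coeff m p = k) : ∃ q, map (Int.castRingHom ℚ) q = p := by
  change p ∈ Set.range (map (Int.castRingHom ℚ))
  rw [mem_range_map_iff_coeffs_subset]
  intro c hc
  obtain ⟨m, -, rfl⟩ := mem_coeffs_iff.mp hc
  obtain ⟨k, hk⟩ := hp m
  exact ⟨k, by simp [hk]⟩

theorem exists_smul_eq_map_intCast (p : MvPolynomial (Fin 2) ℚ) :
    ∃ (d : ℤ) (q : MvPolynomial (Fin 2) ℤ), d ≠ 0 ∧ map (Int.castRingHom ℚ) q = (d : ℚ) • p := by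
  obtain ⟨d, hd⟩ := IsLocalization.exist_integer_multiples (nonZeroDivisors ℤ) p.support
    fun m => coeff m p
  obtain ⟨q, hq⟩ : ∃ q, map (Int.castRingHom ℚ) q = ((d : ℤ) : ℚ) • p := by
    apply exists_map_intCast_eq
    intro m
    by_cases hm : m ∈ p.support
    · obtain ⟨k, hk⟩ := hd m hm
      refine ⟨k, ?_⟩
      rw [coeff_smul, smul_eq_mul]
      simpa using hk.symm
    · exact ⟨0, by simp [notMem_support_iff.mp hm]⟩
  exact ⟨d, q, nonZeroDivisors.ne_zero d.2, hq⟩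

theorem IsOddSymmPoly.smul {R : Type*} [CommRing R] (c : R) {p : MvPolynomial (Fin 2) R}
    (hp : IsOddSymmPoly p) : IsOddSymmPoly (c • p) := by
  simp only [IsOddSymmPoly, map_smul, hp.1, hp.2, smul_neg, and_self]

theorem IsOddSymmPoly.eq_zero_of_image_eq_zero {p : MvPolynomial (Fin 2) ℚ}
    (hp : IsOddSymmPoly p) (h : alphaPoly p = 0) : p = 0 := by
  obtain ⟨d, q, hd, hq⟩ := exists_smul_eq_map_intCast p
  have hinj : Function.Injective (Int.castRingHom ℚ) := Int.cast_injective
  have hqs : IsOddSymmPoly q := .of_map hinj (hq ▸ hp.smul _)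
  have hq0 : q = 0 := by
    apply hqs.eq_zero_of_image_eq_zero_int
    apply map_injective _ hinj
    rw [map_alphaPoly, hq, alphaPoly_smul, h, smul_zero, map_zero]
  rw [hq0, map_zero, eq_comm, smul_eq_zero] at hq
  exact hq.resolve_left (by exact_mod_cast hd)

theorem alphaMap_eq_alphaPoly : alphaMap = alphaPoly := rfl

theorem memVsym.alphaMap {w : ℕ} {p : MvPolynomial (Fin 2) ℚ} (hp : memVsym w p) :
    memVsym w (alphaMap p) :=
  ⟨IsHomogeneous.alphaPoly hp.1, IsOddSymmPoly.alphaPoly_isOddSymmPoly hp.2⟩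

/-- The space of symmetric odd homogeneous polynomials as a subspace. -/
def symmOddSubmodule (w : ℕ) : Submodule ℚ (MvPolynomial (Fin 2) ℚ) where
  carrier := {p | memVsym w p}
  zero_mem' := ⟨isHomogeneous_zero _ _ _, by simp [sub2], by simp [sub2]⟩
  add_mem' {p q} hp hq := by
    refine ⟨hp.1.add hq.1, ?_, ?_⟩
    · rw [sub2, map_add, neg_add]
      exact congrArg₂ _ hp.2.1 hq.2.1
    · rw [sub2, map_add]
      exact congrArg₂ _ hp.2.2 hq.2.2
  smul_mem' c p hp :=
    ⟨(homogeneousSubmodule (Fin 2) ℚ w).smul_mem c hp.1, IsOddSymmPoly.smul c hp.2⟩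

instance (w : ℕ) : FiniteDimensional ℚ (symmOddSubmodule w) := by
  have : FiniteDimensional ℚ (homogeneousSubmodule (Fin 2) ℚ w) :=
    Module.Finite.iff_fg.mpr (homogeneousSubmodule_fg _ _ w)
  have hle : symmOddSubmodule w ≤ homogeneousSubmodule (Fin 2) ℚ w := fun _ hp => hp.1
  exact Submodule.finiteDimensional_of_le hle

/-- The operator `α` as a linear endomorphism of the space of symmetric odd polynomials. -/
noncomputable def alphaLinear (w : ℕ) : symmOddSubmodule w →ₗ[ℚ] symmOddSubmodule w where
  toFun p := ⟨alphaMap p, memVsym.alphaMap p.2⟩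
  map_add' p q := Subtype.ext (alphaPoly_add (p : MvPolynomial (Fin 2) ℚ) q)
  map_smul' c p := Subtype.ext (alphaPoly_smul c (p : MvPolynomial (Fin 2) ℚ))

theorem alphaLinear_injective (w : ℕ) : Function.Injective (alphaLinear w) := by
  rw [injective_iff_map_eq_zero]
  intro p hp
  exact Subtype.ext (IsOddSymmPoly.eq_zero_of_image_eq_zero p.2.2 (congrArg Subtype.val hp))

theorem stmt11 (w : ℕ) (hw : Even w) :
    (∀ p, memVsym w p → memVsym w (alphaMap p)) ∧
    (∀ p, memVsym w p → (∀ m : Fin 2 →₀ ℕ, ∃ k : ℤ, coeff m p = (k : ℚ)) →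
      ∀ m : Fin 2 →₀ ℕ, ∃ k : ℤ,
        coeff m (alphaMap (alphaMap p)) - coeff m p = 3 * (k : ℚ)) ∧
    Set.BijOn alphaMap {p | memVsym w p} {p | memVsym w p} := by
  refine ⟨fun p hp => hp.alphaMap, fun p hp hint m => ?_, fun p hp => hp.alphaMap, ?_, ?_⟩
  · obtain ⟨q, rfl⟩ := exists_map_intCast_eq hint
    obtain ⟨r, hr⟩ := IsOddSymmPoly.three_dvd (.of_map Int.cast_injective hp.2)
    refine ⟨coeff m r, ?_⟩
    rw [alphaMap_eq_alphaPoly, ← map_alphaPoly, ← map_alphaPoly, ← coeff_sub, ← map_sub, hr,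
      coeff_map, coeff_C_mul]
    simp
  · intro p hp q hq h
    exact congrArg Subtype.val
      (@alphaLinear_injective w ⟨p, hp⟩ ⟨q, hq⟩ (Subtype.ext h))
  · intro p hp
    obtain ⟨q, hq⟩ := LinearMap.injective_iff_surjective.mp (alphaLinear_injective w) ⟨p, hp⟩
    exact ⟨q, q.2, congrArg Subtype.val hq⟩
end

section
/- Let w be an odd positive integer and set K = (w−1)/2. The (K+1)×(K+1) rational matrix with entries a_{m,n} = δ_{m,n} + C(w−1−2m, 2n−1) + C(2m, 2n−1), for 0 ≤ m,n ≤ K, has nonzero determinant. (Indeed this matrix is congruent to the identity matrix modulo 2.) -/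
/-- Binomial coefficient `C(a,b)` with the convention that it vanishes for `b < 0`
(or `a < 0`) or `b > a`. -/
def Cb (a b : ℤ) : ℚ :=
  if 0 ≤ a ∧ 0 ≤ b then (Nat.choose a.toNat b.toNat : ℚ) else 0

theorem Nat.even_choose_two_mul_odd (a j : ℕ) : Even (Nat.choose (2 * a) (2 * j + 1)) := by
  rcases a with _ | a
  · simp
  · have h := Nat.add_one_mul_choose_eq (2 * a + 1) (2 * j)
    have h2 : Even (Nat.choose (2 * a + 2) (2 * j + 1) * (2 * j + 1)) := by
      rw [← h]
      exact Even.mul_right ⟨a + 1, by omega⟩ _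
    rcases Nat.even_mul.mp h2 with h3 | h3
    · exact h3
    · exact absurd h3 (by simp)

theorem Cb_even_odd (a b : ℤ) : ∃ k : ℤ, Cb (2 * a) (2 * b - 1) = 2 * (k : ℚ) := by
  unfold Cb
  split_ifs with h
  · obtain ⟨c, hc⟩ := Nat.even_choose_two_mul_odd a.toNat (b - 1).toNat
    have h1 : (2 * a).toNat = 2 * a.toNat := by omega
    have h2 : (2 * b - 1).toNat = 2 * (b - 1).toNat + 1 := by omega
    refine ⟨c, ?_⟩
    rw [h1, h2, hc]
    push_cast
    ring
  · exact ⟨0, by simp⟩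

theorem Matrix.det_one_add_two_smul_ne_zero {ι : Type*} [Fintype ι] [DecidableEq ι]
    (B : Matrix ι ι ℤ) : (1 + (2 : ℤ) • B).det ≠ 0 := by
  intro h
  have h1 := congrArg (Int.castRingHom (ZMod 2)) h
  rw [RingHom.map_det] at h1
  have h2 : (Int.castRingHom (ZMod 2)).mapMatrix (1 + (2 : ℤ) • B) = 1 := by
    have h3 : (2 : ZMod 2) = 0 := rfl
    rw [map_add, map_one, add_eq_left]
    ext i j
    simp only [RingHom.mapMatrix_apply, Matrix.map_apply, Matrix.smul_apply, smul_eq_mul, map_mul]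
    simp [h3]
  rw [h2] at h1
  simp at h1

theorem stmt12 (w : ℕ) (hw : Odd w) (hpos : 0 < w) (K : ℕ) (hK : K = (w - 1) / 2) :
    Matrix.det (Matrix.of fun m n : Fin (K + 1) =>
      (if m = n then (1 : ℚ) else 0)
        + Cb ((w : ℤ) - 1 - 2 * (m.val : ℤ)) (2 * (n.val : ℤ) - 1)
        + Cb (2 * (m.val : ℤ)) (2 * (n.val : ℤ) - 1)) ≠ 0 := by
  choose f hf using Cb_even_odd
  have hwK : (w : ℤ) = 2 * K + 1 := by
    obtain ⟨r, rfl⟩ := hw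
    omega
  let B : Matrix (Fin (K + 1)) (Fin (K + 1)) ℤ :=
    Matrix.of fun m n => f (K - m.val) n.val + f m.val n.val
  have hB : (Matrix.of fun m n : Fin (K + 1) =>
      (if m = n then (1 : ℚ) else 0)
        + Cb ((w : ℤ) - 1 - 2 * (m.val : ℤ)) (2 * (n.val : ℤ) - 1)
        + Cb (2 * (m.val : ℤ)) (2 * (n.val : ℤ) - 1)) =
      (Int.castRingHom ℚ).mapMatrix (1 + (2 : ℤ) • B) := by
    rw [map_add, map_one]
    ext m n
    have h1 : (w : ℤ) - 1 - 2 * (m.val : ℤ) = 2 * ((K : ℤ) - m.val) := by omega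
    simp only [Matrix.of_apply, h1, hf, Matrix.add_apply, Matrix.one_apply, B]
    simp
    ring
  rw [hB, ← RingHom.map_det]
  simpa using Matrix.det_one_add_two_smul_ne_zero B
end

section
/- Let w be an odd positive integer and set K = (w−1)/2. The (K+1)×(K+1) rational matrix with entries a_{m,n} = C(2m, w−2n) + C(w−2m, 2n), for 0 ≤ m,n ≤ K, has nonzero determinant. -/
theorem even_choose_two_mul_of_odd (m : ℕ) {b : ℕ} (hb : Odd b) : Even ((2 * m).choose b) := by
  obtain ⟨c, rfl⟩ := hb
  rcases m with _ | m
  · simp [Nat.choose_eq_zero_of_lt]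
  · have h := Nat.add_one_mul_choose_eq (2 * m + 1) (2 * c)
    have h2 : Even ((2 * (m + 1)).choose (2 * c + 1) * (2 * c + 1)) := by
      rw [show 2 * (m + 1) = 2 * m + 1 + 1 by ring, ← h]
      exact Even.mul_right ⟨m + 1, by ring⟩ _
    rcases Nat.even_mul.mp h2 with h3 | h3
    · exact h3
    · exact absurd h3 (by simp [parity_simps])

theorem Cb_eq_choose (a b : ℕ) {x y : ℤ} (hx : x = a) (hy : y = b) : Cb x y = a.choose b := by
  subst hx hy
  simp [Cb]

/-- An integer matrix that is congruent modulo 2 to an anti-triangular matrix with odd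
anti-diagonal has nonzero determinant. -/
theorem det_ne_zero_of_antitriangular_mod_two {k : ℕ} (N : Matrix (Fin k) (Fin k) ℤ)
    (hdiag : ∀ i, Odd (N i i.rev)) (hlt : ∀ i j, i.rev < j → Even (N i j)) : N.det ≠ 0 := by
  intro h0
  let P : Matrix (Fin k) (Fin k) (ZMod 2) :=
    ((Int.castRingHom (ZMod 2)).mapMatrix N).submatrix id Fin.revPerm
  have hP : P.det = 0 := by
    rw [Matrix.det_permute', ← RingHom.map_det, h0]
    simp
  have htri : P.IsUpperTriangular := by
    intro i j hij
    have : Even (N i j.rev) := hlt i j.rev (Fin.rev_lt_rev.mpr hij)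
    simpa [P] using (ZMod.intCast_eq_zero_iff_even).mpr this
  rw [Matrix.det_of_isUpperTriangular htri, Finset.prod_eq_one] at hP
  · exact one_ne_zero hP
  · intro i _
    simpa [P] using (ZMod.intCast_eq_one_iff_odd).mpr (hdiag i)

theorem stmt13 (w : ℕ) (hw : Odd w) (hpos : 0 < w) (K : ℕ) (hK : K = (w - 1) / 2) :
    Matrix.det (Matrix.of fun m n : Fin (K + 1) =>
      Cb (2 * (m.val : ℤ)) ((w : ℤ) - 2 * (n.val : ℤ))
        + Cb ((w : ℤ) - 2 * (m.val : ℤ)) (2 * (n.val : ℤ))) ≠ 0 := by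
  obtain rfl : w = 2 * K + 1 := by obtain ⟨c, rfl⟩ := hw; omega
  let N : Matrix (Fin (K + 1)) (Fin (K + 1)) ℤ := Matrix.of fun m n =>
    (((2 * m.val).choose (2 * (K - n.val) + 1) + (2 * (K - m.val) + 1).choose (2 * n.val) : ℕ) : ℤ)
  have hN : N.det ≠ 0 := by
    apply det_ne_zero_of_antitriangular_mod_two
    · intro i
      simp only [N, Matrix.of_apply, Int.odd_coe_nat, Fin.val_rev]
      refine (even_choose_two_mul_of_odd _ ⟨_, rfl⟩).add_odd ?_
      rw [show K + 1 - (i.val + 1) = K - i.val by omega, Nat.choose_succ_self_right]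
      exact ⟨_, rfl⟩
    · intro i j hij
      rw [Fin.lt_def, Fin.val_rev] at hij
      simp only [N, Matrix.of_apply, Int.even_coe_nat]
      rw [Nat.choose_eq_zero_of_lt (show 2 * (K - i.val) + 1 < 2 * j.val by omega), add_zero]
      exact even_choose_two_mul_of_odd _ ⟨_, rfl⟩
  have hmap : (Matrix.of fun m n : Fin (K + 1) =>
      Cb (2 * (m.val : ℤ)) (((2 * K + 1 : ℕ) : ℤ) - 2 * (n.val : ℤ))
        + Cb (((2 * K + 1 : ℕ) : ℤ) - 2 * (m.val : ℤ)) (2 * (n.val : ℤ)))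
      = (Int.castRingHom ℚ).mapMatrix N := by
    ext m n
    have hm := m.isLt
    have hn := n.isLt
    simp only [N, Matrix.of_apply, RingHom.mapMatrix_apply, Matrix.map_apply]
    rw [Cb_eq_choose (2 * m.val) (2 * (K - n.val) + 1) (by omega) (by omega),
      Cb_eq_choose (2 * (K - m.val) + 1) (2 * n.val) (by omega) (by omega)]
    simp
  rw [hmap, ← RingHom.map_det]
  simpa using hN
end

section
/- Let w be an odd positive integer and set K = (w−1)/2. The (K+1)×(K+1) rational matrix with entries a_{m,n} = δ_{n,m} − C(w−2m, 2n−2m) − C(2m, 2n), for 0 ≤ m,n ≤ K, has nonzero determinant. (In fact its determinant is not divisible by 3.) -/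
/-- In characteristic three, an odd function of two variables that equals the sum of its traces
over the upper and the lower unipotent subgroups of `SL₂(𝔽₃)` vanishes. -/
theorem eq_zero_of_eq_sum_unipotent_traces {R : Type*} [CommRing R] (h3 : (3 : R) = 0)
    (F : R → R → R) (hodd : ∀ x y, F (-x) (-y) = -F x y)
    (hF : ∀ x y, F x y + F x (x + y) + F x (-x + y) + F (y + x) y + F (-y + x) y = 0)
    (x y : R) : F x y = 0 := by
  have hthree (a : R) : a + a + a = 0 := by linear_combination a * h3
  have hdouble (a b : R) : a + (a + b) = -a + b := by linear_combination a * h3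
  obtain ⟨G, hG⟩ : ∃ G : R → R → R, ∀ x y, G x y = F x y + F x (x + y) + F x (-x + y) :=
    ⟨_, fun _ _ => rfl⟩
  obtain ⟨H, hH⟩ : ∃ H : R → R → R, ∀ x y, H x y = F x y + F (y + x) y + F (-y + x) y :=
    ⟨_, fun _ _ => rfl⟩
  have hFGH (x y : R) : F x y = G x y + H x y := by
    rw [hG, hH]; linear_combination -hF x y
  have hGper (x y : R) : G x (x + y) = G x y := by
    rw [hG, hG, hdouble, neg_add_cancel_left]; ring
  have hHper (x y : R) : H (y + x) y = H x y := by
    rw [hH, hH, hdouble, neg_add_cancel_left]; ring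
  have hGper' (x y : R) : G x (-x + y) = G x y := by
    rw [← hGper x (-x + y), add_neg_cancel_left]
  have hHper' (x y : R) : H (-y + x) y = H x y := by
    rw [← hHper (-y + x) y, add_neg_cancel_left]
  have hGodd (x y : R) : G (-x) (-y) = -G x y := by
    rw [hG, hG, ← neg_add, ← neg_add, hodd, hodd, hodd]; ring
  have hHG (x y : R) : H x y = G x y + G (y + x) y + G (-y + x) y := by
    rw [hH x y, hFGH x y, hFGH (y + x) y, hFGH (-y + x) y, hHper, hHper']
    linear_combination hthree (H x y)
  have hGH (x y : R) : G x y = H x y + H x (x + y) + H x (-x + y) := by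
    rw [hG x y, hFGH x y, hFGH x (x + y), hFGH x (-x + y), hGper, hGper']
    linear_combination hthree (G x y)
  have hG0 (x y : R) : G x y = 0 := by
    have e₁ : G (y + x) y = G (y + x) (-x) := by
      rw [← hGper' (y + x) y]; congr 1; ring
    have e₂ : G (-y + x) y = -G (-x + y) (-x) := by
      rw [← hGodd, ← hGper (-y + x) y]; congr 1 <;> ring
    have e₃ : G (x + y + x) (x + y) = G (-x + y) (-x) := by
      rw [← hGper' (x + y + x) (x + y)]; congr 1
      · linear_combination x * h3
      · ring
    have e₄ : G (-(x + y) + x) (x + y) = -G y (-x) := by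
      rw [← hGodd, ← hGper (-(x + y) + x) (x + y)]; congr 1 <;> ring
    have e₅ : G (-x + y + x) (-x + y) = G y (-x) := by
      rw [← hGper' y (-x)]
      rw [← hGper y (-y + -x), ← hGper y (y + (-y + -x))]; congr 1 <;> ring
    have e₆ : G (-(-x + y) + x) (-x + y) = -G (y + x) (-x) := by
      rw [← hGodd, ← hGper (-(-x + y) + x) (-x + y)]; congr 1
      · linear_combination x * h3
      · ring
    rw [hGH, hHG x y, hHG x (x + y), hHG x (-x + y), hGper, hGper', e₁, e₂, e₃, e₄, e₅, e₆]
    linear_combination hthree (G x y)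
  simp [hFGH, hHG, hG0]

theorem sum_range_two_mul {M : Type*} [AddCommMonoid M] (g : ℕ → M) (k : ℕ) :
    ∑ i ∈ Finset.range (2 * k), g i = ∑ j ∈ Finset.range k, (g (2 * j) + g (2 * j + 1)) := by
  induction k with
  | zero => simp
  | succ k ih =>
    rw [mul_add_one, Finset.sum_range_succ, Finset.sum_range_succ, ih, Finset.sum_range_succ,
      add_assoc]

/-- Twice the even part in `x` of `(x + y) ^ N`. -/
theorem add_pow_add_neg_add_pow {R : Type*} [CommRing R] (x y : R) {N k : ℕ} (h : N < 2 * k) :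
    (x + y) ^ N + (-x + y) ^ N =
      2 * ∑ j ∈ Finset.range k, (N.choose (2 * j) : R) * x ^ (2 * j) * y ^ (N - 2 * j) := by
  have hpow (z : R) : (z + y) ^ N =
      ∑ i ∈ Finset.range (2 * k), z ^ i * y ^ (N - i) * (N.choose i : R) := by
    rw [add_pow]
    refine Finset.sum_subset (Finset.range_subset_range.2 h) fun i _ hi => ?_
    rw [Nat.choose_eq_zero_of_lt (by simpa using hi), Nat.cast_zero, mul_zero]
  rw [hpow, hpow, ← Finset.sum_add_distrib, sum_range_two_mul, Finset.mul_sum]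
  refine Finset.sum_congr rfl fun j _ => ?_
  rw [(even_two_mul j).neg_pow, (odd_two_mul_add_one j).neg_pow]
  ring

/-- The integer matrix with entries `δ_{n,m} - C(2K+1-2m, 2n-2m) - C(2m, 2n)`. -/
def periodMatrix (K : ℕ) : Matrix (Fin (K + 1)) (Fin (K + 1)) ℤ :=
  Matrix.of fun m n => (if n = m then 1 else 0)
    - (if m.val ≤ n.val then ((2 * K + 1 - 2 * m.val).choose (2 * n.val - 2 * m.val) : ℤ) else 0)
    - ((2 * m.val).choose (2 * n.val) : ℤ)

theorem sum_periodMatrix_row {R : Type*} [CommRing R] (h3 : (3 : R) = 0) (K : ℕ)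
    (m : Fin (K + 1)) (x y : R) :
    ∑ n : Fin (K + 1), (periodMatrix K m n : R) * (x ^ (2 * n.val) * y ^ (2 * K + 1 - 2 * n.val)) =
      x ^ (2 * m.val) * y ^ (2 * K + 1 - 2 * m.val)
        + x ^ (2 * m.val) * (x + y) ^ (2 * K + 1 - 2 * m.val)
        + x ^ (2 * m.val) * (-x + y) ^ (2 * K + 1 - 2 * m.val)
        + (y + x) ^ (2 * m.val) * y ^ (2 * K + 1 - 2 * m.val)
        + (-y + x) ^ (2 * m.val) * y ^ (2 * K + 1 - 2 * m.val) := by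
  have hm : m.val ≤ K := Nat.lt_succ_iff.1 m.isLt
  have hneg : (-y + x) ^ (2 * m.val) = (-x + y) ^ (2 * m.val) := by
    rw [← (even_two_mul m.val).neg_pow]; congr 1; ring
  have hU := add_pow_add_neg_add_pow x y
    (N := 2 * K + 1 - 2 * m.val) (k := K + 1 - m.val) (by lia)
  have hL := add_pow_add_neg_add_pow x y (N := 2 * m.val) (k := K + 1) (by lia)
  have hU' : ∑ n : Fin (K + 1), ((if m.val ≤ n.val then
        ((2 * K + 1 - 2 * m.val).choose (2 * n.val - 2 * m.val) : R) else 0) *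
        (x ^ (2 * n.val) * y ^ (2 * K + 1 - 2 * n.val))) =
      x ^ (2 * m.val) * ∑ j ∈ Finset.range (K + 1 - m.val),
        ((2 * K + 1 - 2 * m.val).choose (2 * j) : R) * x ^ (2 * j) *
          y ^ (2 * K + 1 - 2 * m.val - 2 * j) := by
    rw [Fin.sum_univ_eq_sum_range (fun n => (if m.val ≤ n then
        ((2 * K + 1 - 2 * m.val).choose (2 * n - 2 * m.val) : R) else 0) *
        (x ^ (2 * n) * y ^ (2 * K + 1 - 2 * n))) (K + 1)]
    have hk : Finset.range (K + 1) = Finset.range (m.val + (K + 1 - m.val)) := by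
      rw [Nat.add_sub_cancel' m.isLt.le]
    rw [hk, Finset.sum_range_add, Finset.sum_eq_zero, zero_add, Finset.mul_sum]
    · refine Finset.sum_congr rfl fun j _ => ?_
      rw [if_pos (Nat.le_add_right _ _), mul_add, Nat.add_sub_cancel_left, pow_add, Nat.sub_sub]
      ring
    · intro j hj
      rw [if_neg (by simpa using hj), zero_mul]
  have hL' : ∑ n : Fin (K + 1), (((2 * m.val).choose (2 * n.val) : R) *
        (x ^ (2 * n.val) * y ^ (2 * K + 1 - 2 * n.val))) =
      (∑ j ∈ Finset.range (K + 1), ((2 * m.val).choose (2 * j) : R) * x ^ (2 * j) *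
          y ^ (2 * m.val - 2 * j)) * y ^ (2 * K + 1 - 2 * m.val) := by
    rw [Fin.sum_univ_eq_sum_range (fun n => ((2 * m.val).choose (2 * n) : R) *
        (x ^ (2 * n) * y ^ (2 * K + 1 - 2 * n))) (K + 1), Finset.sum_mul]
    refine Finset.sum_congr rfl fun j _ => ?_
    rcases le_or_gt j m.val with hj | hj
    · rw [show 2 * K + 1 - 2 * j = (2 * m.val - 2 * j) + (2 * K + 1 - 2 * m.val) by lia, pow_add]
      ring
    · rw [Nat.choose_eq_zero_of_lt (by lia)]
      simp
  have hsplit : ∑ n : Fin (K + 1),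
        (periodMatrix K m n : R) * (x ^ (2 * n.val) * y ^ (2 * K + 1 - 2 * n.val)) =
      x ^ (2 * m.val) * y ^ (2 * K + 1 - 2 * m.val)
        - (∑ n : Fin (K + 1), ((if m.val ≤ n.val then
          ((2 * K + 1 - 2 * m.val).choose (2 * n.val - 2 * m.val) : R) else 0) *
          (x ^ (2 * n.val) * y ^ (2 * K + 1 - 2 * n.val))))
        - ∑ n : Fin (K + 1), (((2 * m.val).choose (2 * n.val) : R) *
          (x ^ (2 * n.val) * y ^ (2 * K + 1 - 2 * n.val))) := by
    simp [periodMatrix, sub_mul, Finset.sum_sub_distrib, ite_mul]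
  rw [hsplit, hU', hL', hneg, add_comm y x]
  set SU := ∑ j ∈ Finset.range (K + 1 - m.val),
    ((2 * K + 1 - 2 * m.val).choose (2 * j) : R) * x ^ (2 * j) *
      y ^ (2 * K + 1 - 2 * m.val - 2 * j)
  set SL := ∑ j ∈ Finset.range (K + 1), ((2 * m.val).choose (2 * j) : R) * x ^ (2 * j) *
    y ^ (2 * m.val - 2 * j)
  linear_combination -x ^ (2 * m.val) * hU - y ^ (2 * K + 1 - 2 * m.val) * hL
    - (x ^ (2 * m.val) * SU + SL * y ^ (2 * K + 1 - 2 * m.val)) * h3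

open Polynomial in
theorem not_three_dvd_det_periodMatrix (K : ℕ) : ¬ (3 : ℤ) ∣ (periodMatrix K).det := by
  intro hdvd
  have hdet : ((periodMatrix K).map (Int.castRingHom (ZMod 3))).det = 0 := by
    rw [← RingHom.mapMatrix_apply, ← RingHom.map_det]
    exact (ZMod.intCast_zmod_eq_zero_iff_dvd _ 3).2 hdvd
  obtain ⟨c, hc, hker⟩ := Matrix.exists_vecMul_eq_zero_iff.2 hdet
  have h3 : (3 : (ZMod 3)[X]) = 0 := by
    exact_mod_cast CharP.cast_eq_zero (ZMod 3)[X] 3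
  set F : (ZMod 3)[X] → (ZMod 3)[X] → (ZMod 3)[X] := fun x y =>
    ∑ m : Fin (K + 1), C (c m) * (x ^ (2 * m.val) * y ^ (2 * K + 1 - 2 * m.val)) with hFdef
  have hF0 : F X 1 = 0 := by
    refine eq_zero_of_eq_sum_unipotent_traces h3 F (fun x y => ?_) (fun x y => ?_) X 1
    · simp only [hFdef, ← Finset.sum_neg_distrib]
      refine Finset.sum_congr rfl fun m _ => ?_
      have hm := m.isLt
      rw [(even_two_mul m.val).neg_pow,
        (show Odd (2 * K + 1 - 2 * m.val) from ⟨K - m.val, by lia⟩).neg_pow]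
      ring
    · calc _ = ∑ m : Fin (K + 1), C (c m) * ∑ n : Fin (K + 1), (periodMatrix K m n : (ZMod 3)[X]) *
            (x ^ (2 * n.val) * y ^ (2 * K + 1 - 2 * n.val)) := by
            simp only [sum_periodMatrix_row h3, mul_add, Finset.sum_add_distrib, hFdef]
        _ = ∑ n : Fin (K + 1),
              C (Matrix.vecMul c ((periodMatrix K).map (Int.castRingHom (ZMod 3))) n) *
              (x ^ (2 * n.val) * y ^ (2 * K + 1 - 2 * n.val)) := by
            simp only [Finset.mul_sum]
            rw [Finset.sum_comm]
            refine Finset.sum_congr rfl fun n _ => ?_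
            simp [Matrix.vecMul, dotProduct, Finset.sum_mul, mul_assoc]
        _ = 0 := by simp only [hker, Pi.zero_apply, C_0, zero_mul, Finset.sum_const_zero]
  refine hc (funext fun n => ?_)
  have hcoeff := congrArg (fun p => coeff p (2 * n.val)) hF0
  simpa [hFdef, finsetSum_coeff, coeff_X_pow, Fin.val_inj] using hcoeff

theorem stmt14 (w : ℕ) (hw : Odd w) (hpos : 0 < w) (K : ℕ) (hK : K = (w - 1) / 2) :
    Matrix.det (Matrix.of fun m n : Fin (K + 1) =>
      (if n = m then (1 : ℚ) else 0)
        - Cb ((w : ℤ) - 2 * (m.val : ℤ)) (2 * (n.val : ℤ) - 2 * (m.val : ℤ))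
        - Cb (2 * (m.val : ℤ)) (2 * (n.val : ℤ))) ≠ 0 := by
  obtain rfl : w = 2 * K + 1 := by
    obtain ⟨k, rfl⟩ := hw
    lia
  have hmap : (Matrix.of fun m n : Fin (K + 1) =>
      (if n = m then (1 : ℚ) else 0)
        - Cb (((2 * K + 1 : ℕ) : ℤ) - 2 * (m.val : ℤ)) (2 * (n.val : ℤ) - 2 * (m.val : ℤ))
        - Cb (2 * (m.val : ℤ)) (2 * (n.val : ℤ))) =
      (periodMatrix K).map (Int.castRingHom ℚ) := by
    ext m n
    have hm := m.isLt
    have h₁ : Cb (((2 * K + 1 : ℕ) : ℤ) - 2 * (m.val : ℤ)) (2 * (n.val : ℤ) - 2 * (m.val : ℤ)) =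
        if m.val ≤ n.val then
          ((2 * K + 1 - 2 * m.val).choose (2 * n.val - 2 * m.val) : ℚ) else 0 := by
      rw [Cb]
      refine if_congr (by omega) ?_ rfl
      congr 2 <;> lia
    have h₂ : Cb (2 * (m.val : ℤ)) (2 * (n.val : ℤ)) =
        ((2 * m.val).choose (2 * n.val) : ℚ) := by
      rw [Cb, if_pos (by lia)]
      congr 2
    simp only [periodMatrix, Matrix.map_apply, Matrix.of_apply, h₁, h₂]
    push_cast [Int.coe_castRingHom]
    rfl
  rw [hmap, ← RingHom.mapMatrix_apply, ← RingHom.map_det]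
  intro h
  refine not_three_dvd_det_periodMatrix K ?_
  rw [show (periodMatrix K).det = 0 by simpa using h]
  exact dvd_zero 3
end

section
/- Let w ≥ 3 be an odd integer and set K = (w−1)/2. Then the determinant of the K×K rational matrix with entries C(2m,2n) − C(w−2m,2n), for 1 ≤ m,n ≤ K, equals s·K!, where s = −1 if w ≡ 5 (mod 8) and s = 1 otherwise. -/
open Finset in
/-- The odd power `(t - 1) ^ (2k + 1)`, with the terms of the binomial expansion paired up. -/
theorem sub_one_pow_odd_eq_sum {R : Type*} [CommRing R] (t : R) (k : ℕ) :
    (t - 1) ^ (2 * k + 1) = ∑ l ∈ range (k + 1),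
      (-1) ^ (k + l) * ((2 * k + 1).choose (k - l) : R) * (t ^ (k + 1 + l) - t ^ (k - l)) := by
  rw [sub_eq_add_neg, add_pow, show 2 * k + 1 + 1 = (k + 1) + (k + 1) by ring, sum_range_add,
    ← sum_range_reflect (n := k + 1), ← sum_add_distrib]
  refine sum_congr rfl fun l hl => ?_
  have hl' : l ≤ k := by simpa [Nat.lt_succ_iff] using hl
  obtain ⟨d, rfl⟩ := Nat.exists_eq_add_of_le hl'
  have h1 : l + d + 1 - 1 - l = d := by omega
  have h2 : 2 * (l + d) + 1 - d = 2 * l + d + 1 := by omega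
  have h3 : 2 * (l + d) + 1 - (l + d + 1 + l) = d := by omega
  have h4 : l + d - l = d := by omega
  have h5 : (2 * (l + d) + 1).choose (l + d + 1 + l) = (2 * (l + d) + 1).choose d :=
    Nat.choose_symm_of_eq_add (by ring)
  have h6 : (-1 : R) ^ (l + d + l) = (-1) ^ d := by
    rw [show l + d + l = 2 * l + d by ring, pow_add, pow_mul]
    simp
  have h7 : (-1 : R) ^ (2 * l + d + 1) = -(-1) ^ d := by
    rw [pow_succ, pow_add, pow_mul]
    simp
  rw [h1, h2, h3, h4, h5, h6, h7]
  ring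

/-- The signed permutation matrix relating the differences `t ^ (2m) - t ^ (2K + 1 - 2m)` to the
differences `t ^ (K + 1 + k) - t ^ (K - k)`. -/
def foldMatrix (K : ℕ) : Matrix (Fin K) (Fin K) ℚ :=
  Matrix.of fun m k => (if 2 * m.val + 1 = K + k.val then 1 else 0)
    - (if 2 * m.val + k.val + 2 = K then 1 else 0)

theorem det_foldMatrix_add_two (K : ℕ) :
    (foldMatrix (K + 2)).det = (-1) ^ (K + 1) * (foldMatrix K).det := by
  rw [Matrix.det_succ_row _ (Fin.last (K + 1)), Finset.sum_eq_single (Fin.last (K + 1))]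
  rotate_left
  · intro k _ hk
    have hk' : k.val ≠ K + 1 := fun h => hk (Fin.ext h)
    have h0 : foldMatrix (K + 2) (Fin.last (K + 1)) k = 0 := by
      simp only [foldMatrix, Matrix.of_apply, Fin.val_last]
      rw [if_neg (by omega), if_neg (by omega), sub_zero]
    rw [h0]
    ring
  · simp
  rw [Matrix.det_succ_column _ (Fin.last K), Finset.sum_eq_single 0]
  rotate_left
  · intro m _ hm
    have hm' : m.val ≠ 0 := fun h => hm (Fin.ext h)
    have h0 : (foldMatrix (K + 2)).submatrix (Fin.last (K + 1)).succAbove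
        (Fin.last (K + 1)).succAbove m (Fin.last K) = 0 := by
      simp only [foldMatrix, Matrix.of_apply, Matrix.submatrix_apply, Fin.succAbove_last,
        Fin.val_castSucc, Fin.val_last]
      rw [if_neg (by omega), if_neg (by omega), sub_zero]
    rw [h0]
    ring
  · simp
  have h1 : foldMatrix (K + 2) (Fin.last (K + 1)) (Fin.last (K + 1)) = 1 := by
    simp only [foldMatrix, Matrix.of_apply, Fin.val_last]
    rw [if_pos (by omega), if_neg (by omega), sub_zero]
  have h2 : (foldMatrix (K + 2)).submatrix (Fin.last (K + 1)).succAbove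
      (Fin.last (K + 1)).succAbove 0 (Fin.last K) = -1 := by
    rw [Matrix.submatrix_apply, Fin.succAbove_last, foldMatrix, Matrix.of_apply,
      if_neg (by simp only [Fin.val_castSucc, Fin.val_last, Fin.val_zero]; omega),
      if_pos (by simp only [Fin.val_castSucc, Fin.val_last, Fin.val_zero]; omega), zero_sub]
  have h3 : (((foldMatrix (K + 2)).submatrix (Fin.last (K + 1)).succAbove
      (Fin.last (K + 1)).succAbove).submatrix (Fin.succAbove 0) (Fin.last K).succAbove)
      = foldMatrix K := by
    ext m k
    simp only [foldMatrix, Matrix.of_apply, Matrix.submatrix_apply, Fin.succAbove_last,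
      Fin.val_castSucc, Fin.succAbove_zero, Fin.val_succ]
    congr 1 <;> exact if_congr (by omega) rfl rfl
  rw [h1, h2, h3, Fin.val_last, Fin.val_last, Fin.val_zero, ← two_mul, pow_mul]
  ring

theorem det_foldMatrix : ∀ K : ℕ, (foldMatrix K).det = if K % 4 = 2 then -1 else 1
  | 0 => by simp
  | 1 => by simp [foldMatrix]
  | K + 2 => by
    rw [det_foldMatrix_add_two, det_foldMatrix K]
    rcases Nat.even_or_odd K with h | h
    · rw [h.add_one.neg_one_pow]
      obtain ⟨j, rfl⟩ := h
      split_ifs <;> first | omega | norm_num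
    · rw [h.add_one.neg_one_pow]
      obtain ⟨j, rfl⟩ := h
      split_ifs <;> first | omega | norm_num

/-- Coefficients of `x ^ (2n + 2)` in `(1 + x) ^ (K + 1 + k) - (1 + x) ^ (K - k)`. -/
def centeredMatrix (K : ℕ) : Matrix (Fin K) (Fin K) ℚ :=
  Matrix.of fun k n => ((K + 1 + k.val).choose (2 * n.val + 2) : ℚ)
    - ((K - k.val).choose (2 * n.val + 2) : ℚ)

/-- The change of basis from the differences `t ^ (K + 1 + l) - t ^ (K - l)` to the polynomials
`(t - 1) ^ (2k + 1) * t ^ (K - k)`. -/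
def pairingMatrix (K : ℕ) : Matrix (Fin K) (Fin K) ℚ :=
  Matrix.of fun k l => if l ≤ k then
    (-1) ^ (k.val + l.val) * ((2 * k.val + 1).choose (k.val - l.val) : ℚ) else 0

theorem det_pairingMatrix (K : ℕ) : (pairingMatrix K).det = 1 := by
  rw [Matrix.det_of_isLowerTriangular]
  · refine Finset.prod_eq_one fun k _ => ?_
    simp [pairingMatrix, ← two_mul]
  · intro k l hkl
    have h : k < l := hkl
    simp [pairingMatrix, h]

open Finset Polynomial in
theorem pairingMatrix_mul_centeredMatrix (K : ℕ) (k n : Fin K) :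
    (pairingMatrix K * centeredMatrix K) k n
      = ((X ^ (2 * k.val + 1) * (1 + X) ^ (K - k.val) : ℚ[X]).coeff (2 * n.val + 2)) := by
  have hX : (X : ℚ[X]) ^ (2 * k.val + 1) = ∑ l ∈ range (k.val + 1),
      C ((-1) ^ (k.val + l) * ((2 * k.val + 1).choose (k.val - l) : ℚ)) *
        ((1 + X) ^ (k.val + 1 + l) - (1 + X) ^ (k.val - l)) := by
    have h := sub_one_pow_odd_eq_sum (1 + X : ℚ[X]) k.val
    rw [add_sub_cancel_left] at h
    simpa using h
  rw [hX, sum_mul, finsetSum_coeff, Matrix.mul_apply]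
  have hterm : ∀ l ∈ range (k.val + 1),
      (C ((-1) ^ (k.val + l) * ((2 * k.val + 1).choose (k.val - l) : ℚ)) *
        ((1 + X) ^ (k.val + 1 + l) - (1 + X) ^ (k.val - l)) * (1 + X) ^ (K - k.val)).coeff
          (2 * n.val + 2)
      = (-1) ^ (k.val + l) * ((2 * k.val + 1).choose (k.val - l) : ℚ) *
        (((K + 1 + l).choose (2 * n.val + 2) : ℚ) - ((K - l).choose (2 * n.val + 2) : ℚ)) := by
    intro l hl
    have hl' : l ≤ k.val := by simpa [Nat.lt_succ_iff] using hl
    rw [mul_assoc, coeff_C_mul, sub_mul, ← pow_add, ← pow_add, coeff_sub, coeff_one_add_X_pow,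
      coeff_one_add_X_pow, show k.val + 1 + l + (K - k.val) = K + 1 + l by omega,
      show k.val - l + (K - k.val) = K - l by omega]
  rw [sum_congr rfl hterm]
  have hsum : ∀ l : Fin K, pairingMatrix K k l * centeredMatrix K l n
      = if l.val ∈ range (k.val + 1) then
        (-1) ^ (k.val + l.val) * ((2 * k.val + 1).choose (k.val - l.val) : ℚ) *
          (((K + 1 + l.val).choose (2 * n.val + 2) : ℚ)
            - ((K - l.val).choose (2 * n.val + 2) : ℚ))
        else 0 := by
    intro l
    simp only [pairingMatrix, centeredMatrix, Matrix.of_apply, mem_range, Nat.lt_succ_iff,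
      Fin.le_def, ite_mul, zero_mul]
  rw [sum_congr rfl fun l _ => hsum l,
    Fin.sum_univ_eq_sum_range (fun l => if l ∈ range (k.val + 1) then
      (-1) ^ (k.val + l) * ((2 * k.val + 1).choose (k.val - l) : ℚ) *
        (((K + 1 + l).choose (2 * n.val + 2) : ℚ) - ((K - l).choose (2 * n.val + 2) : ℚ))
      else 0) K, sum_ite_mem, inter_eq_right.2 (range_subset_range.2 k.isLt)]

open Polynomial in
theorem det_centeredMatrix (K : ℕ) : (centeredMatrix K).det = K.factorial := by
  have h : (pairingMatrix K * centeredMatrix K).det = K.factorial := by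
    rw [Matrix.det_of_isUpperTriangular]
    · have hd : ∀ k : Fin K, (pairingMatrix K * centeredMatrix K) k k = ((K - k.val : ℕ) : ℚ) := by
        intro k
        rw [pairingMatrix_mul_centeredMatrix, coeff_X_pow_mul', if_pos (by omega),
          coeff_one_add_X_pow, show 2 * k.val + 2 - (2 * k.val + 1) = 1 by omega,
          Nat.choose_one_right]
      rw [Finset.prod_congr rfl fun k _ => hd k,
        Fin.prod_univ_eq_prod_range (fun k => ((K - k : ℕ) : ℚ)) K, ← Nat.cast_prod,
        ← Nat.descFactorial_eq_prod_range, Nat.descFactorial_self]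
    · intro k n hkn
      have h : n.val < k.val := hkn
      rw [pairingMatrix_mul_centeredMatrix, coeff_X_pow_mul', if_neg (by omega)]
  rwa [Matrix.det_mul, det_pairingMatrix, one_mul] at h

theorem Cb_natCast (a b : ℕ) : Cb a b = (a.choose b : ℚ) := by
  simp [Cb]

theorem stmt16 (w : ℕ) (hw : Odd w) (hw3 : 3 ≤ w) (K : ℕ) (hK : K = (w - 1) / 2) :
    Matrix.det (Matrix.of fun m n : Fin K =>
      Cb (2 * ((m.val : ℤ) + 1)) (2 * ((n.val : ℤ) + 1))
        - Cb ((w : ℤ) - 2 * ((m.val : ℤ) + 1)) (2 * ((n.val : ℤ) + 1)))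
      = (if w % 8 = 5 then (-1 : ℚ) else 1) * (Nat.factorial K : ℚ) := by
  obtain ⟨j, rfl⟩ := hw
  obtain rfl : K = j := by omega
  have hM : (Matrix.of fun m n : Fin K =>
      Cb (2 * ((m.val : ℤ) + 1)) (2 * ((n.val : ℤ) + 1))
        - Cb (((2 * K + 1 : ℕ) : ℤ) - 2 * ((m.val : ℤ) + 1)) (2 * ((n.val : ℤ) + 1)))
      = foldMatrix K * centeredMatrix K := by
    ext m n
    have hm := m.isLt
    have e1 : 2 * ((m.val : ℤ) + 1) = ((2 * m.val + 2 : ℕ) : ℤ) := by push_cast; ring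
    have e2 : 2 * ((n.val : ℤ) + 1) = ((2 * n.val + 2 : ℕ) : ℤ) := by push_cast; ring
    have e3 : ((2 * K + 1 : ℕ) : ℤ) - ((2 * m.val + 2 : ℕ) : ℤ)
        = ((2 * K - 1 - 2 * m.val : ℕ) : ℤ) := by omega
    rw [Matrix.of_apply, e1, e2, e3, Cb_natCast, Cb_natCast, Matrix.mul_apply]
    by_cases hc : K ≤ 2 * m.val + 1
    · rw [Finset.sum_eq_single ⟨2 * m.val + 1 - K, by omega⟩]
      · simp only [foldMatrix, centeredMatrix, Matrix.of_apply]
        rw [if_pos (by omega), if_neg (by omega),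
          show K + 1 + (2 * m.val + 1 - K) = 2 * m.val + 2 by omega,
          show K - (2 * m.val + 1 - K) = 2 * K - 1 - 2 * m.val by omega]
        ring
      · intro k _ hk
        have hk' : k.val ≠ 2 * m.val + 1 - K := fun h => hk (Fin.ext h)
        simp only [foldMatrix, Matrix.of_apply]
        rw [if_neg (by omega), if_neg (by omega)]
        ring
      · simp
    · rw [Finset.sum_eq_single ⟨K - 2 - 2 * m.val, by omega⟩]
      · simp only [foldMatrix, centeredMatrix, Matrix.of_apply]
        rw [if_neg (by omega), if_pos (by omega),
          show K + 1 + (K - 2 - 2 * m.val) = 2 * K - 1 - 2 * m.val by omega,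
          show K - (K - 2 - 2 * m.val) = 2 * m.val + 2 by omega]
        ring
      · intro k _ hk
        have hk' : k.val ≠ K - 2 - 2 * m.val := fun h => hk (Fin.ext h)
        simp only [foldMatrix, Matrix.of_apply]
        rw [if_neg (by omega), if_neg (by omega)]
        ring
      · simp
  rw [hM, Matrix.det_mul, det_foldMatrix, det_centeredMatrix]
  congr 1
  exact if_congr (by omega) rfl rfl
end

section
/- Let w be an odd positive integer and let 1 ≤ n ≤ (w−1)/2. Define Q_n(x) := (1/(2n)!)·(∏_{j=0}^{2n−1}(w/2 − j + x) − ∏_{j=0}^{2n−1}(w/2 − j − x)) ∈ ℚ[x]. Then Q_n is an odd polynomial, so Q_n(x) = x·P_n(x²) for a unique P_n ∈ ℚ[x]; the polynomial P_n has degree n−1 and its coefficient of x^{n−1} equals (w−2n+1)/(2n−1)!. Moreover, for every integer m with 0 ≤ m ≤ (w−1)/2 one has Q_n(2m − w/2) = C(2m,2n) − C(w−2m,2n). -/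
open Polynomial

/-- `Q_n(x) = (1/(2n)!)·(∏_{j=0}^{2n-1}(w/2 - j + x) - ∏_{j=0}^{2n-1}(w/2 - j - x))`. -/
noncomputable def Qpoly (w n : ℕ) : Polynomial ℚ :=
  Polynomial.C (1 / (Nat.factorial (2 * n) : ℚ)) *
    (∏ j ∈ Finset.range (2 * n), (Polynomial.C ((w : ℚ) / 2 - (j : ℚ)) + Polynomial.X)
      - ∏ j ∈ Finset.range (2 * n), (Polynomial.C ((w : ℚ) / 2 - (j : ℚ)) - Polynomial.X))

theorem Polynomial.coeff_comp_neg_X {R : Type*} [CommRing R] (p : R[X]) (k : ℕ) :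
    (p.comp (-X)).coeff k = (-1) ^ k * p.coeff k := by
  rw [← neg_one_mul (X : R[X]), ← C_1, ← C_neg, comp_C_mul_X_coeff, mul_comm]

namespace Qpoly

/-- The product with factors `w/2 - j + X`; substituting `-X` for `X` gives the other product in `Qpoly`. -/
noncomputable def base (w n : ℕ) : Polynomial ℚ :=
  ∏ j ∈ Finset.range (2 * n), (X + C ((w : ℚ) / 2 - (j : ℚ)))

theorem eq_base (w n : ℕ) :
    Qpoly w n = C (1 / (Nat.factorial (2 * n) : ℚ)) * (base w n - (base w n).comp (-X)) := by
  unfold Qpoly base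
  rw [Polynomial.prod_comp]
  congr 2
  · exact Finset.prod_congr rfl fun j _ => add_comm _ _
  · refine Finset.prod_congr rfl fun j _ => ?_
    rw [add_comp, X_comp, C_comp]
    ring

theorem comp_neg_X (w n : ℕ) : (Qpoly w n).comp (-X) = -Qpoly w n := by
  rw [eq_base]
  simp only [mul_comp, sub_comp, C_comp, comp_assoc, neg_comp, X_comp, neg_neg, comp_X]
  ring

theorem base_monic (w n : ℕ) : (base w n).Monic :=
  monic_prod_of_monic _ _ fun _ _ => monic_X_add_C _

theorem base_natDegree (w n : ℕ) : (base w n).natDegree = 2 * n := by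
  unfold base
  rw [natDegree_prod_of_monic _ _ fun _ _ => monic_X_add_C _]
  simp only [natDegree_X_add_C, Finset.sum_const, Finset.card_range, smul_eq_mul, mul_one]

theorem sum_shift (w : ℚ) (k : ℕ) :
    ∑ j ∈ Finset.range k, (w / 2 - (j : ℚ)) = k * (w - k + 1) / 2 := by
  induction k with
  | zero => simp
  | succ k ih =>
    rw [Finset.sum_range_succ, ih]
    push_cast
    ring

theorem base_coeff (w n : ℕ) (hn : 1 ≤ n) :
    (base w n).coeff (2 * n - 1) = n * ((w : ℚ) - 2 * n + 1) := by
  have h := nextCoeff_of_natDegree_pos (p := base w n) (by rw [base_natDegree]; omega)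
  rw [base_natDegree] at h
  rw [← h, base, Monic.nextCoeff_prod _ _ fun _ _ => monic_X_add_C _]
  simp only [nextCoeff_X_add_C]
  rw [sum_shift]
  push_cast
  ring

theorem coeff_odd (w n i : ℕ) :
    (Qpoly w n).coeff (2 * i + 1)
      = 2 / (Nat.factorial (2 * n) : ℚ) * (base w n).coeff (2 * i + 1) := by
  rw [eq_base, coeff_C_mul, coeff_sub, coeff_comp_neg_X, Odd.neg_one_pow ⟨i, rfl⟩]
  ring

theorem eval_eq (w n m : ℕ) (hm : 2 * m ≤ w) :
    (Qpoly w n).eval (2 * (m : ℚ) - (w : ℚ) / 2)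
      = (Nat.choose (2 * m) (2 * n) : ℚ) - (Nat.choose (w - 2 * m) (2 * n) : ℚ) := by
  have key : ∀ a : ℕ, ∏ j ∈ Finset.range (2 * n), ((a : ℚ) - j)
      = (Nat.factorial (2 * n) : ℚ) * (Nat.choose a (2 * n) : ℚ) := by
    intro a
    rw [← descPochhammer_eval_eq_prod_range, descPochhammer_eval_eq_descFactorial,
      Nat.descFactorial_eq_factorial_mul_choose, Nat.cast_mul]
  have hf : (Nat.factorial (2 * n) : ℚ) ≠ 0 := by positivity
  have h1 := key (2 * m)
  have h2 := key (w - 2 * m)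
  rw [Nat.cast_sub hm] at h2
  push_cast at h1 h2
  simp only [Qpoly, eval_mul, eval_sub, eval_prod, eval_add, eval_C, eval_X]
  have e1 (j : ℕ) : (w : ℚ) / 2 - j + (2 * m - w / 2) = 2 * m - j := by ring
  have e2 (j : ℕ) : (w : ℚ) / 2 - j - (2 * m - w / 2) = w - 2 * m - j := by ring
  simp only [e1, e2]
  rw [h1, h2]
  field_simp

end Qpoly

theorem Polynomial.eq_X_mul_comp_sq_iff {q P : Polynomial ℚ} (hq : q.comp (-X) = -q) :
    q = X * P.comp (X ^ 2) ↔ ∀ i, P.coeff i = q.coeff (2 * i + 1) := by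
  rw [← expand_eq_comp_X_pow]
  constructor
  · intro h i
    rw [h, coeff_X_mul, mul_comm, coeff_expand_mul two_pos]
  · intro h
    ext k
    obtain ⟨i, rfl | rfl⟩ := Nat.even_or_odd' k
    · have hk := congrArg (coeff · (2 * i)) hq
      simp only [coeff_comp_neg_X, coeff_neg, Even.neg_one_pow ⟨i, two_mul i⟩] at hk
      have h0 : q.coeff (2 * i) = 0 := by linarith
      rw [h0]
      cases i with
      | zero => simp
      | succ i =>
        rw [show 2 * (i + 1) = 2 * i + 1 + 1 by ring, coeff_X_mul, coeff_expand two_pos,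
          if_neg (by omega)]
    · rw [coeff_X_mul, mul_comm 2 i, coeff_expand_mul two_pos, h, mul_comm 2 i]

theorem stmt17 (w : ℕ) (hw : Odd w) (hpos : 0 < w)
    (n : ℕ) (hn1 : 1 ≤ n) (hn2 : n ≤ (w - 1) / 2) :
    (Qpoly w n).comp (-Polynomial.X) = -Qpoly w n ∧
    (∃! P : Polynomial ℚ, Qpoly w n = Polynomial.X * P.comp (Polynomial.X ^ 2)) ∧
    (∀ P : Polynomial ℚ, Qpoly w n = Polynomial.X * P.comp (Polynomial.X ^ 2) →
      P.natDegree = n - 1 ∧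
      P.coeff (n - 1) = ((w : ℚ) - 2 * (n : ℚ) + 1) / (Nat.factorial (2 * n - 1) : ℚ)) ∧
    (∀ m : ℕ, m ≤ (w - 1) / 2 →
      (Qpoly w n).eval (2 * (m : ℚ) - (w : ℚ) / 2)
        = (Nat.choose (2 * m) (2 * n) : ℚ) - (Nat.choose (w - 2 * m) (2 * n) : ℚ)) := by
  have hodd := Qpoly.comp_neg_X w n
  refine ⟨hodd, ?_, ?_, fun m hm => Qpoly.eval_eq w n m (by omega)⟩
  · refine ⟨contract 2 (divX (Qpoly w n)), (eq_X_mul_comp_sq_iff hodd).2 fun i => ?_,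
      fun P hP => ?_⟩
    · rw [coeff_contract two_ne_zero, coeff_divX, mul_comm]
    · ext i
      rw [(eq_X_mul_comp_sq_iff hodd).1 hP, coeff_contract two_ne_zero, coeff_divX, mul_comm]
  · intro P hP
    have hcoeff := (eq_X_mul_comp_sq_iff hodd).1 hP
    have hlead : P.coeff (n - 1)
        = ((w : ℚ) - 2 * (n : ℚ) + 1) / (Nat.factorial (2 * n - 1) : ℚ) := by
      rw [hcoeff, Qpoly.coeff_odd, show 2 * (n - 1) + 1 = 2 * n - 1 by omega,
        Qpoly.base_coeff w n hn1, ← Nat.mul_factorial_pred (n := 2 * n) (by omega)]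
      have hf : (Nat.factorial (2 * n - 1) : ℚ) ≠ 0 := by positivity
      have hn : (n : ℚ) ≠ 0 := by positivity
      push_cast
      field_simp
    refine ⟨natDegree_eq_of_le_of_coeff_ne_zero ?_ ?_, hlead⟩
    · refine natDegree_le_iff_coeff_eq_zero.2 fun i hi => ?_
      rw [hcoeff, Qpoly.coeff_odd,
        coeff_eq_zero_of_natDegree_lt (by rw [Qpoly.base_natDegree]; omega), mul_zero]
    · have hw' : (2 * n : ℚ) ≤ w := by exact_mod_cast (by omega : 2 * n ≤ w)
      rw [hlead]
      exact div_ne_zero (by linarith) (by positivity)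
end
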